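/- Let n be a positive integer, H = ℚ(ζ_n + ζ_n⁻¹), and ℓ an odd prime with q ≡ 1 (mod ℓ) for some prime factor q of n. Assume there is a real quadratic subfield K_2 ⊆ H with the ℓ-class number of H equal to ℓ^m and the ℓ-class number of K_2 equal to ℓ^{m-1}, and that for every pair of subfields F ⊆ K of H with K_2 ⊆ F, [K:F] = ℓ, ℓ-class number of F equal to ℓ^{m-1} and of K equal to ℓ^m, the ℓ-part of ker(t_{F→K}) is trivial or isomorphic to (ℤ/ℓℤ)^r for some positive integer r. If the ℓ-rank of the class group of K_2 is 1 (i.e., C(K_2)_ℓ is cyclic), then C(H)_ℓ ≅ ℤ/ℓ^mℤ or C(H)_ℓ ≅ ℤ/ℓ^{m-1}ℤ ⊕ ℤ/ℓℤ. -/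

import Mathlib

open NumberField IntermediateField Module
open scoped nonZeroDivisors

noncomputable section

namespace PaperStmt

/-- `ζ_n = exp(2πi/n)`, a primitive `n`-th root of unity (for `n > 0`). -/
def zetaC (n : ℕ) : ℂ := Complex.exp (2 * (Real.pi : ℂ) * Complex.I / n)

/-- The maximal real subfield `ℚ(ζ_n + ζ_n⁻¹)` of the cyclotomic field `ℚ(ζ_n)`. -/
def realCyclo (n : ℕ) : IntermediateField ℚ ℂ := ℚ⟮zetaC n + (zetaC n)⁻¹⟯

lemma isIntegral_of_pow_eq_one {x : ℂ} {k : ℕ} (hk : k ≠ 0) (h : x ^ k = 1) :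
    IsIntegral ℚ x :=
  ⟨Polynomial.X ^ k - Polynomial.C 1, Polynomial.monic_X_pow_sub_C 1 hk, by
    simp [h]⟩

lemma zetaC_pow (n : ℕ) (hn : n ≠ 0) : zetaC n ^ n = 1 := by
  have hn' : (n : ℂ) ≠ 0 := Nat.cast_ne_zero.mpr hn
  rw [zetaC, ← Complex.exp_nat_mul, mul_comm ((n : ℂ)), div_mul_cancel₀ _ hn',
    Complex.exp_two_pi_mul_I]

lemma isIntegral_zetaC_add_inv (n : ℕ) : IsIntegral ℚ (zetaC n + (zetaC n)⁻¹) := by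
  rcases eq_or_ne n 0 with h | h
  · have h1 : zetaC 0 = 1 := by simp [zetaC]
    subst h
    rw [h1, inv_one]
    exact isIntegral_one.add isIntegral_one
  · exact (isIntegral_of_pow_eq_one h (zetaC_pow n h)).add
      (isIntegral_of_pow_eq_one h (by rw [inv_pow, zetaC_pow n h, inv_one]))

instance (n : ℕ) : FiniteDimensional ℚ (realCyclo n) :=
  IntermediateField.adjoin.finiteDimensional (isIntegral_zetaC_add_inv n)

instance (E : IntermediateField ℚ ℂ) [FiniteDimensional ℚ E] : NumberField E := ⟨⟩

/-- The `p`-part (`p`-primary component / `p`-Sylow subgroup) of a commutative group. -/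
def pPart (G : Type*) [CommGroup G] (p : ℕ) (hp : p.Prime) : Subgroup G :=
  haveI : Fact p.Prime := ⟨hp⟩
  CommGroup.primaryComponent G p

/-- The `p`-class number: the order of the `p`-part. -/
def pCard (G : Type*) [CommGroup G] (p : ℕ) (hp : p.Prime) : ℕ :=
  Nat.card (pPart G p hp)

/-- The `p`-rank: `dim_{F_p} (G_p / G_p^p)`, read off as the exponent of `p`
in the order of the elementary abelian group `G_p / G_p^p`. -/
def pRank (G : Type*) [CommGroup G] (p : ℕ) (hp : p.Prime) : ℕ :=
  (Nat.card
    (↥(pPart G p hp) ⧸ (powMonoidHom p : ↥(pPart G p hp) →* ↥(pPart G p hp)).range)).factorization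
    p

/-- `t` is the homomorphism of class groups induced by extension of ideals along `F ⊆ K`:
it sends the class of a nonzero ideal `I` of `𝓞 F` to the class of `I · 𝓞 K`. -/
def IsClassGroupExtHom {F K : IntermediateField ℚ ℂ} [NumberField F] [NumberField K]
    (hFK : F ≤ K) (t : ClassGroup (𝓞 F) →* ClassGroup (𝓞 K)) : Prop :=
  ∀ (I : (Ideal (𝓞 F))⁰) (J : (Ideal (𝓞 K))⁰),
    Ideal.map (RingOfIntegers.mapRingHom (IntermediateField.inclusion hFK))
        (I : Ideal (𝓞 F)) = (J : Ideal (𝓞 K)) →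
    t (ClassGroup.mk0 I) = ClassGroup.mk0 J

section

open IsDedekindDomain Filter Topology

section EulerProduct

variable {R : Type*} [CommRing R] [IsDedekindDomain R]

/-- The set of ideals all of whose prime factors lie in `S`. -/
def idealsFactoredBy (S : Finset (HeightOneSpectrum R)) : Set (Ideal R) :=
  {I | ∀ P : HeightOneSpectrum R, P.asIdeal ∣ I → P ∈ S}

lemma one_sub_mul_tsum_idealsFactoredBy_insert (g : Ideal R →*₀ ℂ) (hg : Summable g)
    (S : Finset (HeightOneSpectrum R)) [DecidableEq (HeightOneSpectrum R)]
    (P : HeightOneSpectrum R) (hP : P ∉ S) :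
    (1 - g P.asIdeal) * ∑' I, (idealsFactoredBy (insert P S)).indicator g I =
      ∑' I, (idealsFactoredBy S).indicator g I := by
  have hinj : Function.Injective (fun J : Ideal R => P.asIdeal * J) :=
    fun J J' h => mul_left_cancel₀ P.ne_bot h
  have hg0 : g ⊥ = 0 := map_zero g
  have key : ∀ I, (idealsFactoredBy (insert P S)).indicator g I =
      (idealsFactoredBy S).indicator g I + {I | P.asIdeal ∣ I}.indicator
        ((idealsFactoredBy (insert P S)).indicator g) I := by
    intro I
    rcases eq_or_ne I 0 with rfl | hI
    · simp [Set.indicator, hg0]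
    by_cases hd : P.asIdeal ∣ I
    · have h1 : I ∉ idealsFactoredBy S := fun h => hP (h P hd)
      rw [Set.indicator_of_notMem h1, zero_add,
        Set.indicator_of_mem (s := {I | P.asIdeal ∣ I}) (by exact hd)]
    · rw [Set.indicator_of_notMem (s := {I | P.asIdeal ∣ I}) (by exact hd), add_zero]
      have h2 : I ∈ idealsFactoredBy (insert P S) ↔ I ∈ idealsFactoredBy S := by
        refine forall₂_congr fun Q hQ => ?_
        rw [Finset.mem_insert, or_iff_right]
        rintro rfl
        exact hd hQ
      by_cases h : I ∈ idealsFactoredBy S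
      · rw [Set.indicator_of_mem h, Set.indicator_of_mem (h2.mpr h)]
      · rw [Set.indicator_of_notMem h, Set.indicator_of_notMem (mt h2.mp h)]
  have hA := hg.indicator (idealsFactoredBy S)
  have hB := hg.indicator (idealsFactoredBy (insert P S))
  have hC := hB.indicator {I | P.asIdeal ∣ I}
  have h3 : ∑' I, {I | P.asIdeal ∣ I}.indicator
      ((idealsFactoredBy (insert P S)).indicator g) I =
      g P.asIdeal * ∑' I, (idealsFactoredBy (insert P S)).indicator g I := by
    rw [← hinj.tsum_eq, ← tsum_mul_left]
    · refine tsum_congr fun J => ?_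
      rw [Set.indicator_of_mem (s := {I | P.asIdeal ∣ I}) (by exact dvd_mul_right _ _)]
      have h4 : P.asIdeal * J ∈ idealsFactoredBy (insert P S) ↔
          J ∈ idealsFactoredBy (insert P S) := by
        refine ⟨fun h Q hQ => h Q (hQ.mul_left _), fun h Q hQ => ?_⟩
        rcases Q.prime.dvd_or_dvd hQ with h5 | h5
        · rw [Finset.mem_insert]
          left
          ext1
          have := Ideal.dvd_iff_le.mp h5
          exact (P.isMaximal.eq_of_le Q.isPrime.ne_top this).symm
        · exact h Q h5
      by_cases h : J ∈ idealsFactoredBy (insert P S)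
      · rw [Set.indicator_of_mem h, Set.indicator_of_mem (h4.mpr h), map_mul]
      · rw [Set.indicator_of_notMem h, Set.indicator_of_notMem (mt h4.mp h), mul_zero]
    · intro I hI
      have : P.asIdeal ∣ I := by
        by_contra h
        exact hI (Set.indicator_of_notMem (s := {I | P.asIdeal ∣ I}) (by exact h) _)
      obtain ⟨J, rfl⟩ := this
      exact ⟨J, rfl⟩
  have h6 := tsum_congr (L := .unconditional _) key
  rw [hA.tsum_add hC, h3] at h6
  linear_combination h6

lemma prod_one_sub_mul_tsum_idealsFactoredBy (g : Ideal R →*₀ ℂ) (hg : Summable g)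
    (S : Finset (HeightOneSpectrum R)) :
    (∏ P ∈ S, (1 - g P.asIdeal)) * ∑' I, (idealsFactoredBy S).indicator g I = 1 := by
  classical
  induction S using Finset.induction_on with
  | empty =>
    rw [Finset.prod_empty, one_mul, tsum_eq_single 1]
    · rw [Set.indicator_of_mem, map_one]
      intro P hP
      exact absurd (isUnit_of_dvd_one hP) P.prime.not_isUnit
    · intro I hI
      rcases eq_or_ne I 0 with rfl | hI0
      · simp [Set.indicator, show g ⊥ = 0 from map_zero g]
      apply Set.indicator_of_notMem
      intro h
      obtain ⟨m, hm, hIm⟩ := Ideal.exists_le_maximal I (by simpa using hI)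
      have := h ⟨m, hm.isPrime, fun h => hI0 (by rw [h] at hIm; exact le_bot_iff.mp hIm)⟩
        (Ideal.dvd_iff_le.mpr hIm)
      simp at this
  | insert P S hP ih =>
    rw [Finset.prod_insert hP, mul_assoc, mul_left_comm,
      one_sub_mul_tsum_idealsFactoredBy_insert g hg S P hP, ih]

/-- Euler product of a completely multiplicative function on the ideals of a Dedekind domain. -/
lemma tendsto_prod_one_sub_inv (g : Ideal R →*₀ ℂ) (hg : Summable g) :
    Tendsto (fun S : Finset (HeightOneSpectrum R) => ∏ P ∈ S, (1 - g P.asIdeal)⁻¹) atTop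
      (𝓝 (∑' I, g I)) := by
  have h1 : ∀ S : Finset (HeightOneSpectrum R), ∏ P ∈ S, (1 - g P.asIdeal)⁻¹ =
      ∑' I, (idealsFactoredBy S).indicator g I := fun S => by
    rw [Finset.prod_inv_distrib]
    exact inv_eq_of_mul_eq_one_right (prod_one_sub_mul_tsum_idealsFactoredBy g hg S)
  simp_rw [h1]
  refine tendsto_tsum_of_dominated_convergence hg.norm (fun I => ?_) (Eventually.of_forall
    fun S I => norm_indicator_le_norm_self _ _)
  rcases eq_or_ne I 0 with rfl | hI
  · simp [Set.indicator, show g ⊥ = 0 from map_zero g]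
  · have hfin := Ideal.finite_factors hI
    refine tendsto_const_nhds.congr' ?_
    filter_upwards [eventually_ge_atTop hfin.toFinset] with S hS
    rw [Set.indicator_of_mem]
    intro P hP
    exact hS (by simpa using hP)

lemma norm_one_sub_le_exp (z : ℂ) : ‖1 - z‖ ≤ Real.exp (-z.re + ‖z‖ ^ 2 / 2) := by
  have h1 : ‖1 - z‖ ^ 2 = 1 - 2 * z.re + ‖z‖ ^ 2 := by
    rw [← Complex.normSq_eq_norm_sq, ← Complex.normSq_eq_norm_sq, Complex.normSq_apply,
      Complex.normSq_apply]
    simp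
    ring
  have h2 := Real.add_one_le_exp (-2 * z.re + ‖z‖ ^ 2)
  refine (sq_le_sq₀ (norm_nonneg _) (Real.exp_pos _).le).mp ?_
  rw [h1, ← Real.exp_nat_mul]
  calc _ ≤ _ := by linarith
    _ ≤ Real.exp (-2 * z.re + ‖z‖ ^ 2) := h2
    _ = _ := by congr 1; push_cast; ring

lemma exp_le_norm_tsum (g : Ideal R →*₀ ℂ) (hg : Summable g)
    (hne : ∀ P : HeightOneSpectrum R, g P.asIdeal ≠ 1)
    (hP : Summable fun P : HeightOneSpectrum R => g P.asIdeal)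
    (hP2 : Summable fun P : HeightOneSpectrum R => ‖g P.asIdeal‖ ^ 2) :
    Real.exp (∑' P : HeightOneSpectrum R, (g P.asIdeal).re -
      (∑' P : HeightOneSpectrum R, ‖g P.asIdeal‖ ^ 2) / 2) ≤ ‖∑' I, g I‖ := by
  have h1 := (tendsto_prod_one_sub_inv g hg).norm
  have h2 := ((Complex.hasSum_re hP.hasSum).sub (hP2.hasSum.div_const 2))
  have h3 := (Real.continuous_exp.tendsto _).comp h2
  rw [Complex.re_tsum hP] at h3
  refine le_of_tendsto_of_tendsto' h3 h1 fun S => ?_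
  simp only [Function.comp_apply, Real.exp_sum, norm_prod]
  refine Finset.prod_le_prod (fun _ _ => (Real.exp_pos _).le) fun P _ => ?_
  rw [norm_inv, ← neg_neg (_ - _ : ℝ), Real.exp_neg]
  refine inv_anti₀ (norm_pos_iff.mpr (sub_ne_zero.mpr (hne P).symm)) ?_
  rw [neg_sub]
  exact (norm_one_sub_le_exp (g P.asIdeal)).trans_eq (by congr 1; ring)

lemma inv_one_sub_le_exp {x : ℝ} (h0 : 0 ≤ x) (h : x ≤ 1 / 2) :
    (1 - x)⁻¹ ≤ Real.exp (x + 2 * x ^ 2) := by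
  have h1 : (1 - x)⁻¹ ≤ x + 2 * x ^ 2 + 1 := by
    rw [inv_le_iff_one_le_mul₀ (by linarith)]
    nlinarith [mul_nonneg h0 (mul_nonneg h0 (sub_nonneg.mpr h))]
  exact h1.trans (Real.add_one_le_exp _)

lemma norm_tsum_le_exp (g : Ideal R →*₀ ℂ) (hg : Summable g)
    (hle : ∀ P : HeightOneSpectrum R, ‖g P.asIdeal‖ ≤ 1 / 2)
    (hP : Summable fun P : HeightOneSpectrum R => ‖g P.asIdeal‖)
    (hP2 : Summable fun P : HeightOneSpectrum R => ‖g P.asIdeal‖ ^ 2) :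
    ‖∑' I, g I‖ ≤ Real.exp (∑' P : HeightOneSpectrum R, ‖g P.asIdeal‖ +
      2 * ∑' P : HeightOneSpectrum R, ‖g P.asIdeal‖ ^ 2) := by
  have h1 := (tendsto_prod_one_sub_inv g hg).norm
  have h3 := (Real.continuous_exp.tendsto _).comp (hP.hasSum.add (hP2.hasSum.mul_left 2))
  refine le_of_tendsto_of_tendsto' h1 h3 fun S => ?_
  simp only [Function.comp_apply, Real.exp_sum, norm_prod]
  refine Finset.prod_le_prod (fun _ _ => norm_nonneg _) fun P _ => ?_
  refine le_trans ?_ (inv_one_sub_le_exp (norm_nonneg _) (hle P))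
  rw [norm_inv]
  refine inv_anti₀ (by linarith [hle P]) ?_
  have := norm_sub_norm_le (1 : ℂ) (g P.asIdeal)
  simpa using this

end EulerProduct

section Density

variable {ι : Type*} {N : ι → ℕ}

lemma hasSum_rpow_of_finite_fibers (hfin : ∀ k, {i | N i = k}.Finite)
    {s : ℝ} (hs : 0 < s) (hsum : LSeriesSummable (fun k => ((Nat.card {i // N i = k} : ℝ) : ℂ)) s) :
    Summable (fun i => (N i : ℝ) ^ (-s)) ∧
      LSeries (fun k => ((Nat.card {i // N i = k} : ℝ) : ℂ)) s =
        ((∑' i, (N i : ℝ) ^ (-s) : ℝ) : ℂ) := by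
  have hterm : ∀ k, LSeries.term (fun k => ((Nat.card {i // N i = k} : ℝ) : ℂ)) s k =
      (((Nat.card {i // N i = k} : ℝ) * (k : ℝ) ^ (-s) : ℝ) : ℂ) := by
    intro k
    rcases eq_or_ne k 0 with rfl | hk
    · simp [Real.zero_rpow (neg_ne_zero.mpr hs.ne')]
    · rw [LSeries.term_of_ne_zero hk, Complex.ofReal_mul, Complex.ofReal_cpow (by positivity),
        div_eq_mul_inv, ← Complex.cpow_neg]
      simp
  have hsum' : Summable fun k : ℕ => (Nat.card {i // N i = k} : ℝ) * (k : ℝ) ^ (-s) := by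
    rw [← Complex.summable_ofReal]
    exact hsum.congr hterm
  have hfib : ∀ k, ∀ x : {i // N i = k},
      (N (Equiv.sigmaFiberEquiv N ⟨k, x⟩) : ℝ) ^ (-s) = (k : ℝ) ^ (-s) := by
    rintro k ⟨i, rfl⟩
    rfl
  have hF : ∀ k, Finite {i // N i = k} := fun k => (hfin k).to_subtype
  have hfibsum : ∀ k, ∑' x : {i // N i = k},
      (N (Equiv.sigmaFiberEquiv N ⟨k, x⟩) : ℝ) ^ (-s) =
        (Nat.card {i // N i = k} : ℝ) * (k : ℝ) ^ (-s) := by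
    intro k
    rw [tsum_congr (hfib k), tsum_const, nsmul_eq_mul]
  have hS : Summable (fun i => (N i : ℝ) ^ (-s)) := by
    rw [← (Equiv.sigmaFiberEquiv N).summable_iff]
    refine (summable_sigma_of_nonneg fun x => Real.rpow_nonneg (Nat.cast_nonneg _) _).mpr ⟨fun k => ?_, ?_⟩
    · have := hF k
      exact Summable.of_finite
    · refine hsum'.congr fun k => (hfibsum k).symm
  refine ⟨hS, ?_⟩
  rw [LSeries, tsum_congr hterm, ← Complex.ofReal_tsum, ← (Equiv.sigmaFiberEquiv N).tsum_eq]
  congr 1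
  have h1 := (Equiv.sigmaFiberEquiv N).summable_iff.mpr hS
  refine Eq.trans ?_ (Summable.tsum_sigma' (fun k => by have := hF k; exact Summable.of_finite)
    h1).symm
  exact tsum_congr fun k => (hfibsum k).symm

lemma tendsto_sub_one_mul_tsum_rpow (hN : ∀ i, 0 < N i) (hfin : ∀ k, {i | N i = k}.Finite)
    {l : ℝ} (hl : Tendsto (fun x : ℝ => (Nat.card {i // (N i : ℝ) ≤ x} : ℝ) / x) atTop (𝓝 l)) :
    (∀ s : ℝ, 1 < s → Summable (fun i => (N i : ℝ) ^ (-s))) ∧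
    Tendsto (fun s : ℝ => (s - 1) * ∑' i, (N i : ℝ) ^ (-s)) (𝓝[>] 1) (𝓝 l) := by
  have h1 : Tendsto (fun n : ℕ => (∑ k ∈ Finset.Icc 1 n, (Nat.card {i // N i = k} : ℝ)) / n)
      atTop (𝓝 l) := by
    refine (hl.comp tendsto_natCast_atTop_atTop).congr fun n => ?_
    simp only [Function.comp_apply, Nat.cast_le, ← Nat.cast_sum]
    congr 2
    rw [← Finset.card_preimage_eq_sum_card_image_eq (fun k _ => hfin k)]
    refine Nat.card_congr (Equiv.subtypeEquivRight fun i => ?_)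
    simp [Nat.one_le_iff_ne_zero, (hN i).ne']
  have h2 : ∀ s : ℝ, 1 < s →
      LSeriesSummable (fun k => ((Nat.card {i // N i = k} : ℝ) : ℂ)) s := fun s hs =>
    LSeriesSummable_of_sum_norm_bigO_and_nonneg
      (Asymptotics.isBigO_atTop_natCast_rpow_of_tendsto_div_rpow (a := l) (by simpa using h1))
      (fun _ => Nat.cast_nonneg _) zero_le_one (by simpa using hs)
  refine ⟨fun s hs => (hasSum_rpow_of_finite_fibers hfin (by linarith) (h2 s hs)).1, ?_⟩
  have h3 := LSeries_tendsto_sub_mul_nhds_one_of_tendsto_sum_div_and_nonneg _ h1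
    (fun _ => Nat.cast_nonneg _)
  rw [← Filter.tendsto_ofReal_iff]
  refine h3.congr' ?_
  filter_upwards [self_mem_nhdsWithin] with s hs
  rw [(hasSum_rpow_of_finite_fibers hfin (by linarith [Set.mem_Ioi.mp hs])
    (h2 s hs)).2]
  push_cast
  rfl

end Density

section IdealClasses

variable (K : Type*) [Field K] [NumberField K]

/-- The common density of the ideals in the ideal classes of `K`. -/
def classDensity : ℝ :=
  (2 ^ InfinitePlace.nrRealPlaces K * (2 * Real.pi) ^ InfinitePlace.nrComplexPlaces K *
    Units.regulator K) / (Units.torsionOrder K * Real.sqrt |discr K|)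

lemma classDensity_pos : 0 < classDensity K := by
  refine div_pos (mul_pos (by positivity) (Units.regulator_pos K)) ?_
  exact mul_pos (Nat.cast_pos.mpr (Units.torsionOrder_pos K)) <|
    Real.sqrt_pos_of_pos <| abs_pos.mpr (Int.cast_ne_zero.mpr (discr_ne_zero K))

variable {K}

lemma absNorm_pos_of_mem (I : (Ideal (𝓞 K))⁰) : 0 < Ideal.absNorm (I : Ideal (𝓞 K)) :=
  Ideal.absNorm_pos_of_nonZeroDivisors I

lemma finite_absNorm_eq (k : ℕ) : {I : (Ideal (𝓞 K))⁰ | Ideal.absNorm (I : Ideal (𝓞 K)) = k}.Finite :=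
  (Ideal.finite_setOfPred_absNorm_le₀ k).subset fun _ h => le_of_eq h

lemma summable_absNorm_rpow {s : ℝ} (hs : 1 < s) :
    Summable fun I : (Ideal (𝓞 K))⁰ => (Ideal.absNorm (I : Ideal (𝓞 K)) : ℝ) ^ (-s) :=
  (tendsto_sub_one_mul_tsum_rpow (N := fun I : (Ideal (𝓞 K))⁰ => Ideal.absNorm (I : Ideal (𝓞 K)))
    absNorm_pos_of_mem finite_absNorm_eq (NumberField.Ideal.tendsto_norm_le_div_atTop₀ K)).1 s hs

lemma tendsto_sub_one_mul_tsum_class (C : ClassGroup (𝓞 K)) :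
    Tendsto (fun s : ℝ => (s - 1) * ∑' I : {I : (Ideal (𝓞 K))⁰ // ClassGroup.mk0 I = C},
      (Ideal.absNorm (I : Ideal (𝓞 K)) : ℝ) ^ (-s)) (𝓝[>] 1) (𝓝 (classDensity K)) := by
  refine (tendsto_sub_one_mul_tsum_rpow
    (N := fun I : {I : (Ideal (𝓞 K))⁰ // ClassGroup.mk0 I = C} => Ideal.absNorm (I : Ideal (𝓞 K)))
    (fun I => absNorm_pos_of_mem I.1) (fun k => ?_) ?_).2
  · exact (finite_absNorm_eq k).preimage Subtype.val_injective.injOn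
  · refine (NumberField.Ideal.tendsto_norm_le_and_mk_eq_div_atTop K C).congr fun x => ?_
    congr 2
    refine Nat.card_congr ((Equiv.subtypeEquivRight fun I => and_comm).trans
      (Equiv.subtypeSubtypeEquivSubtypeInter _ _).symm)

lemma tendsto_sub_one_mul_tsum_absNorm :
    Tendsto (fun s : ℝ => (s - 1) * ∑' I : (Ideal (𝓞 K))⁰,
      (Ideal.absNorm (I : Ideal (𝓞 K)) : ℝ) ^ (-s)) (𝓝[>] 1)
      (𝓝 (classNumber K * classDensity K)) := by
  convert (tendsto_sub_one_mul_tsum_rpow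
    (N := fun I : (Ideal (𝓞 K))⁰ => Ideal.absNorm (I : Ideal (𝓞 K)))
    absNorm_pos_of_mem finite_absNorm_eq (NumberField.Ideal.tendsto_norm_le_div_atTop₀ K)).2 using 2
  rw [classDensity]
  ring

end IdealClasses

section Cone

lemma abs_rpow_neg_sub_rpow_neg_le {u v m s : ℝ} (hm : 0 < m) (hu : m ≤ u) (hv : m ≤ v)
    (hs : 0 < s) : |u ^ (-s) - v ^ (-s)| ≤ s * m ^ (-s - 1) * |u - v| := by
  have h := Convex.norm_image_sub_le_of_norm_hasDerivWithin_le (f := fun x : ℝ => x ^ (-s))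
    (f' := fun x => -s * x ^ (-s - 1)) (s := Set.Ici m) (x := v) (y := u)
    (C := s * m ^ (-s - 1)) ?_ ?_ (convex_Ici m) hv hu
  · simpa only [Real.norm_eq_abs] using h
  · intro x hx
    exact (Real.hasDerivAt_rpow_const (Or.inl (hm.trans_le hx).ne')).hasDerivWithinAt
  · intro x hx
    have hx0 : 0 < x := hm.trans_le hx
    rw [norm_mul, norm_neg, Real.norm_of_nonneg hs.le,
      Real.norm_of_nonneg (Real.rpow_nonneg hx0.le _)]
    exact mul_le_mul_of_nonneg_left
      (Real.rpow_le_rpow_of_nonpos hm hx (by linarith)) hs.le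

lemma summable_rpow_neg_prod {s : ℝ} (hs : 1 < s) :
    Summable fun x : ℕ × ℕ => (((x.1 : ℝ) + x.2 + 1) ^ 2) ^ (-s) := by
  have h1 : Summable fun a : ℕ => ((a : ℝ) + 1) ^ (-s) := by
    have := (summable_nat_add_iff 1).mpr (Real.summable_nat_rpow.mpr (neg_lt_neg hs))
    simpa using this
  have h2 := h1.mul_of_nonneg h1 (fun a => by positivity) (fun a => by positivity)
  refine Summable.of_nonneg_of_le (fun x => by positivity) (fun x => ?_) h2
  rw [← Real.mul_rpow (by positivity) (by positivity)]
  refine Real.rpow_le_rpow_of_nonpos (by positivity) ?_ (by linarith)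
  have h3 : (0 : ℝ) ≤ x.1 := Nat.cast_nonneg _
  have h4 : (0 : ℝ) ≤ x.2 := Nat.cast_nonneg _
  nlinarith [mul_nonneg h3 h4]

/-- The product of the two linear forms `t₁ + p t₂` and `t₁ + p' t₂`. -/
def coneForm (p p' t₁ t₂ : ℝ) : ℝ := (t₁ + p * t₂) * (t₁ + p' * t₂)

lemma le_coneForm {p p' c t₁ t₂ w : ℝ} (hc : 0 < c) (hp : c ≤ p) (hp' : c ≤ p') (h₂ : 0 ≤ t₂)
    (hw : 0 ≤ w) (h : c * w ≤ t₁ + c * t₂) : c ^ 2 * w ^ 2 ≤ coneForm p p' t₁ t₂ := by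
  have h1 : c * w ≤ t₁ + p * t₂ := h.trans (by gcongr)
  have h2 : c * w ≤ t₁ + p' * t₂ := h.trans (by gcongr)
  have h3 : 0 ≤ c * w := by positivity
  calc c ^ 2 * w ^ 2 = (c * w) * (c * w) := by ring
    _ ≤ _ := mul_le_mul h1 h2 h3 (h3.trans h1)

variable {Z : Type*} [Fintype Z] {τ₁ τ₂ : Z → ℝ} {p p' : ℝ}

lemma exists_le_coneForm (h₁ : ∀ z, 0 < τ₁ z) (h₂ : ∀ z, 0 ≤ τ₂ z)
    (hp : 0 < p) (hp' : 0 < p') : ∃ c : ℝ, 0 < c ∧ c ≤ 1 ∧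
      (∀ z (a b : ℕ), c ^ 2 * ((a : ℝ) + b + 1) ^ 2 ≤ coneForm p p' (τ₁ z + a) (τ₂ z + b)) ∧
      (∀ (a b : ℕ), c ^ 2 * ((a : ℝ) + b + 1) ^ 2 ≤ coneForm p p' (a + 1) b) := by
  obtain ⟨c₀, hc₀, hc₀'⟩ : ∃ c₀ : ℝ, 0 < c₀ ∧ ∀ z, c₀ ≤ τ₁ z := by
    rcases isEmpty_or_nonempty Z with h | h
    · exact ⟨1, one_pos, fun z => h.elim z⟩
    · obtain ⟨z, hz⟩ := Finite.exists_min τ₁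
      exact ⟨τ₁ z, h₁ z, hz⟩
  obtain ⟨c, hc, hcle⟩ : ∃ c : ℝ, 0 < c ∧ (c ≤ c₀ ∧ c ≤ 1) ∧ c ≤ p ∧ c ≤ p' :=
    ⟨min (min c₀ 1) (min p p'), by positivity, by simp, by simp, by simp⟩
  refine ⟨c, hc, hcle.1.2, fun z a b => ?_, fun a b => ?_⟩
  · have ha : (0 : ℝ) ≤ a := Nat.cast_nonneg _
    have hb : (0 : ℝ) ≤ b := Nat.cast_nonneg _
    refine le_coneForm hc hcle.2.1 hcle.2.2 (add_nonneg (h₂ z) hb) (by positivity) ?_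
    nlinarith [hcle.1.1, hc₀' z, h₂ z, mul_nonneg hc.le (h₂ z),
      mul_le_mul_of_nonneg_right hcle.1.2 ha]
  · have ha : (0 : ℝ) ≤ a := Nat.cast_nonneg _
    have hb : (0 : ℝ) ≤ b := Nat.cast_nonneg _
    refine le_coneForm hc hcle.2.1 hcle.2.2 hb (by positivity) ?_
    nlinarith [mul_le_mul_of_nonneg_right hcle.1.2 ha, hcle.1.2]

omit [Fintype Z] in
lemma coneForm_sub_le (h₁ : ∀ z, 0 < τ₁ z ∧ τ₁ z ≤ 1) (h₂ : ∀ z, 0 ≤ τ₂ z ∧ τ₂ z < 1)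
    (hp : 0 < p) (hp' : 0 < p') (z : Z) (a b : ℕ) :
    |coneForm p p' (τ₁ z + a) (τ₂ z + b) - coneForm p p' (a + 1) b| ≤
      4 * (1 + p) * (1 + p') * ((a : ℝ) + b + 1) := by
  have ha : (0 : ℝ) ≤ a := Nat.cast_nonneg _
  have hb : (0 : ℝ) ≤ b := Nat.cast_nonneg _
  obtain ⟨x0, x1⟩ := h₁ z
  obtain ⟨y0, y1⟩ := h₂ z
  set W : ℝ := (a : ℝ) + b + 1 with hW
  have key : ∀ r : ℝ, 0 < r → |(τ₁ z + a + r * (τ₂ z + b)) - (a + 1 + r * b)| ≤ 1 + r := by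
    intro r hr
    rw [abs_le]
    constructor <;> nlinarith [mul_nonneg hr.le y0, mul_lt_mul_of_pos_left y1 hr]
  have key2 : ∀ r : ℝ, 0 < r → |τ₁ z + a + r * (τ₂ z + b)| ≤ 2 * (1 + r) * W := by
    intro r hr
    rw [abs_of_nonneg (by positivity)]
    have := mul_nonneg hr.le ha
    have := mul_nonneg hr.le hb
    have := mul_lt_mul_of_pos_left y1 hr
    rw [hW]
    nlinarith
  have key3 : ∀ r : ℝ, 0 < r → |a + 1 + r * b| ≤ 2 * (1 + r) * W := by
    intro r hr
    rw [abs_of_nonneg (by positivity)]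
    have := mul_nonneg hr.le ha
    have := mul_nonneg hr.le hb
    rw [hW]
    nlinarith
  have : coneForm p p' (τ₁ z + a) (τ₂ z + b) - coneForm p p' (a + 1) b =
      (τ₁ z + a + p * (τ₂ z + b)) * ((τ₁ z + a + p' * (τ₂ z + b)) - (a + 1 + p' * b)) +
      ((τ₁ z + a + p * (τ₂ z + b)) - (a + 1 + p * b)) * (a + 1 + p' * b) := by
    rw [coneForm, coneForm]; ring
  rw [this]
  refine (abs_add_le _ _).trans ?_
  rw [abs_mul, abs_mul]
  have e1 := mul_le_mul (key2 p hp) (key p' hp') (abs_nonneg _) (by positivity)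
  have e2 := mul_le_mul (key p hp) (key3 p' hp') (abs_nonneg _) (by positivity)
  linarith

lemma summable_coneForm (h₁ : ∀ z, 0 < τ₁ z) (h₂ : ∀ z, 0 ≤ τ₂ z)
    (hp : 0 < p) (hp' : 0 < p') {s : ℝ} (hs : 1 < s) :
    Summable fun x : Z × ℕ × ℕ => coneForm p p' (τ₁ x.1 + x.2.1) (τ₂ x.1 + x.2.2) ^ (-s) := by
  obtain ⟨c, hc, -, h, -⟩ := exists_le_coneForm h₁ h₂ hp hp'
  have h3 : Summable fun x : Z × ℕ × ℕ =>
      (c ^ 2) ^ (-s) * (((x.2.1 : ℝ) + x.2.2 + 1) ^ 2) ^ (-s) := by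
    have h4 := (summable_rpow_neg_prod hs).mul_left ((c ^ 2) ^ (-s))
    refine (summable_prod_of_nonneg fun x => by positivity).mpr ⟨fun z => h4, Summable.of_finite⟩
  refine Summable.of_nonneg_of_le (fun x => ?_) (fun x => ?_) h3
  · exact Real.rpow_nonneg (le_trans (by positivity) (h _ _ _)) _
  · rw [← Real.mul_rpow (by positivity) (by positivity)]
    exact Real.rpow_le_rpow_of_nonpos (by positivity) (h _ _ _) (by linarith)

/-- A weighted lattice sum over a cone is bounded near `s = 1` if the weights have mean zero. -/
lemma exists_norm_tsum_coneForm_le (h₁ : ∀ z, 0 < τ₁ z ∧ τ₁ z ≤ 1)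
    (h₂ : ∀ z, 0 ≤ τ₂ z ∧ τ₂ z < 1) (hp : 0 < p) (hp' : 0 < p') (f : Z → ℂ)
    (hf : ∑ z, f z = 0) : ∃ B : ℝ, ∀ s : ℝ, 1 < s → s < 2 →
      ‖∑' x : Z × ℕ × ℕ, f x.1 *
        ((coneForm p p' (τ₁ x.1 + x.2.1) (τ₂ x.1 + x.2.2) ^ (-s) : ℝ) : ℂ)‖ ≤ B := by
  obtain ⟨c, hc, hc1, hm, hm0⟩ := exists_le_coneForm (fun z => (h₁ z).1) (fun z => (h₂ z).1) hp hp'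
  set A : ℝ := 2 * (c ^ 2) ^ (-3 : ℝ) * (4 * (1 + p) * (1 + p')) with hA
  have hW : Summable fun x : ℕ × ℕ => (((x.1 : ℝ) + x.2 + 1) ^ 2) ^ (-(3 / 2 : ℝ)) :=
    summable_rpow_neg_prod (by norm_num)
  have hA0 : 0 ≤ A := by positivity
  have hterm : ∀ s : ℝ, 1 < s → s < 2 → ∀ z (x : ℕ × ℕ),
      |coneForm p p' (τ₁ z + x.1) (τ₂ z + x.2) ^ (-s) - coneForm p p' (x.1 + 1) x.2 ^ (-s)| ≤
        A * (((x.1 : ℝ) + x.2 + 1) ^ 2) ^ (-(3 / 2 : ℝ)) := by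
    intro s hs hs2 z x
    set W : ℝ := (x.1 : ℝ) + x.2 + 1 with hWd
    have hW1 : 1 ≤ W := by
      have h3 : (0 : ℝ) ≤ x.1 := Nat.cast_nonneg _
      have h4 : (0 : ℝ) ≤ x.2 := Nat.cast_nonneg _
      linarith
    have hW0 : 0 < W := by linarith
    refine (abs_rpow_neg_sub_rpow_neg_le (by positivity) (hm z x.1 x.2) (hm0 x.1 x.2)
      (by linarith)).trans ?_
    have e1 : (c ^ 2 * W ^ 2) ^ (-s - 1) ≤ (c ^ 2) ^ (-3 : ℝ) * (W ^ 2) ^ (-2 : ℝ) := by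
      rw [Real.mul_rpow (by positivity) (by positivity)]
      refine mul_le_mul ?_ ?_ (by positivity) (by positivity)
      · exact Real.rpow_le_rpow_of_exponent_ge (by positivity) (by nlinarith) (by linarith)
      · exact Real.rpow_le_rpow_of_exponent_le (by nlinarith) (by linarith)
    have e2 : (W ^ 2) ^ (-(3 / 2 : ℝ)) = (W ^ 2) ^ (-2 : ℝ) * W := by
      have e3 : W = (W ^ 2) ^ (1 / 2 : ℝ) := by
        rw [← Real.rpow_natCast, ← Real.rpow_mul hW0.le]
        norm_num
      nth_rw 3 [e3]
      rw [← Real.rpow_add (by positivity)]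
      norm_num
    calc s * (c ^ 2 * W ^ 2) ^ (-s - 1) * _
        ≤ 2 * ((c ^ 2) ^ (-3 : ℝ) * (W ^ 2) ^ (-2 : ℝ)) * (4 * (1 + p) * (1 + p') * W) := by
          refine mul_le_mul (mul_le_mul hs2.le e1 (by positivity) (by norm_num))
            (coneForm_sub_le h₁ h₂ hp hp' z x.1 x.2) (abs_nonneg _) (by positivity)
      _ = _ := by rw [e2, hA]; ring
  refine ⟨∑' x : ℕ × ℕ, (∑ z, ‖f z‖) * (A * (((x.1 : ℝ) + x.2 + 1) ^ 2) ^ (-(3 / 2 : ℝ))),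
    fun s hs hs2 => ?_⟩
  have hsum : ∀ z, Summable fun x : ℕ × ℕ =>
      f z * ((coneForm p p' (τ₁ z + x.1) (τ₂ z + x.2) ^ (-s) : ℝ) : ℂ) := by
    intro z
    have := (summable_coneForm (fun z => (h₁ z).1) (fun z => (h₂ z).1) hp hp' hs).prod_factor z
    exact (Complex.summable_ofReal.mpr this).mul_left _
  have hsumZ : Summable fun x : Z × ℕ × ℕ =>
      f x.1 * ((coneForm p p' (τ₁ x.1 + x.2.1) (τ₂ x.1 + x.2.2) ^ (-s) : ℝ) : ℂ) := by
    refine Summable.of_norm ((summable_prod_of_nonneg fun x => norm_nonneg _).mpr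
      ⟨fun z => (hsum z).norm, Summable.of_finite⟩)
  rw [hsumZ.tsum_prod' hsum, tsum_fintype, ← Summable.tsum_finsetSum fun z _ => hsum z]
  refine tsum_of_norm_bounded ((hW.mul_left A).mul_left _).hasSum fun x => ?_
  have : ∑ z, f z * ((coneForm p p' (τ₁ z + x.1) (τ₂ z + x.2) ^ (-s) : ℝ) : ℂ) =
      ∑ z, f z * ((coneForm p p' (τ₁ z + x.1) (τ₂ z + x.2) ^ (-s) -
        coneForm p p' (x.1 + 1) x.2 ^ (-s) : ℝ) : ℂ) := by
    simp_rw [Complex.ofReal_sub, mul_sub, Finset.sum_sub_distrib, ← Finset.sum_mul, hf]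
    simp
  rw [this, Finset.sum_mul]
  refine (norm_sum_le _ _).trans (Finset.sum_le_sum fun z _ => ?_)
  rw [norm_mul, Complex.norm_real]
  exact mul_le_mul_of_nonneg_left (hterm s hs hs2 z x) (norm_nonneg _)

end Cone

section LatticeCone

variable {A : Type*} [AddCommGroup A] {t₁ t₂ : A →+ ℝ} {v₁ v₂ : A}

/-- The fundamental parallelogram of the lattice spanned by `v₁, v₂`. -/
def coneBox (t₁ t₂ : A →+ ℝ) : Set A := {z | (0 < t₁ z ∧ t₁ z ≤ 1) ∧ (0 ≤ t₂ z ∧ t₂ z < 1)}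

/-- The points of the half-open cone spanned by `v₁, v₂`. -/
def coneSet (t₁ t₂ : A →+ ℝ) : Set A := {z | 0 < t₁ z ∧ 0 ≤ t₂ z}

lemma exists_unique_add_mem_coneBox (h11 : t₁ v₁ = 1) (h12 : t₁ v₂ = 0) (h21 : t₂ v₁ = 0)
    (h22 : t₂ v₂ = 1) (z : A) :
    ∃! ab : ℤ × ℤ, z - (ab.1 • v₁ + ab.2 • v₂) ∈ coneBox t₁ t₂ := by
  have e1 : ∀ a b : ℤ, t₁ (z - (a • v₁ + b • v₂)) = t₁ z - a := by
    intro a b; simp [h11, h12]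
  have e2 : ∀ a b : ℤ, t₂ (z - (a • v₁ + b • v₂)) = t₂ z - b := by
    intro a b; simp [h21, h22]
  refine ⟨(⌈t₁ z⌉ - 1, ⌊t₂ z⌋), ?_, ?_⟩
  · simp only [coneBox, Set.mem_ofPred_eq]
    rw [e1, e2]
    push_cast
    have := Int.le_ceil (t₁ z)
    have := Int.ceil_lt_add_one (t₁ z)
    have := Int.floor_le (t₂ z)
    have := Int.lt_floor_add_one (t₂ z)
    refine ⟨⟨?_, ?_⟩, ?_, ?_⟩ <;> linarith
  · rintro ⟨a, b⟩ h
    simp only [coneBox, Set.mem_ofPred_eq] at h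
    rw [e1, e2] at h
    obtain ⟨⟨h1, h2⟩, h3, h4⟩ := h
    rw [Prod.mk.injEq]
    constructor
    · rw [eq_sub_iff_add_eq, eq_comm, Int.ceil_eq_iff]
      push_cast
      constructor <;> linarith
    · rw [eq_comm, Int.floor_eq_iff]
      constructor <;> linarith

lemma bijective_coneBox_quotient (h11 : t₁ v₁ = 1) (h12 : t₁ v₂ = 0) (h21 : t₂ v₁ = 0)
    (h22 : t₂ v₂ = 1) :
    Function.Bijective fun z : coneBox t₁ t₂ =>
      ((z : A) : A ⧸ AddSubgroup.closure {v₁, v₂}) := by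
  constructor
  · rintro ⟨z, hz⟩ ⟨w, hw⟩ h
    obtain ⟨a, b, hab⟩ := AddSubgroup.mem_closure_pair.mp (QuotientAddGroup.eq.mp h)
    have h1 := (exists_unique_add_mem_coneBox h11 h12 h21 h22 w).unique
      (y₁ := (a, b)) (y₂ := (0, 0)) (by
        show w - (a • v₁ + b • v₂) ∈ _
        rw [hab]
        simpa using hz) (by simpa using hw)
    rw [Prod.mk.injEq] at h1
    rw [h1.1, h1.2, zero_smul, zero_smul, add_zero] at hab
    ext
    show z = w
    rw [← sub_eq_zero, ← neg_eq_zero, neg_sub, sub_eq_neg_add, ← hab]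
  · intro x
    obtain ⟨z, rfl⟩ := QuotientAddGroup.mk_surjective x
    obtain ⟨ab, hab, -⟩ := exists_unique_add_mem_coneBox h11 h12 h21 h22 z
    refine ⟨⟨_, hab⟩, ?_⟩
    rw [QuotientAddGroup.eq]
    refine AddSubgroup.mem_closure_pair.mpr ⟨ab.1, ab.2, ?_⟩
    rw [neg_sub, sub_add_cancel]

lemma sum_coneBox_eq_zero [Fintype (coneBox t₁ t₂)] (h11 : t₁ v₁ = 1) (h12 : t₁ v₂ = 0)
    (h21 : t₂ v₁ = 0) (h22 : t₂ v₂ = 1) (f : A → ℂ) (hf₁ : ∀ z, f (z + v₁) = f z)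
    (hf₂ : ∀ z, f (z + v₂) = f z) (ε : ℂ) (hε : ε ≠ 1)
    (hf : ∀ c : ℕ, c ≠ 0 → ∃ ν : ℕ, c.Coprime ν ∧ ∀ z, f (ν • z) = ε * f z) :
    ∑ z : coneBox t₁ t₂, f z = 0 := by
  set Λ := AddSubgroup.closure {v₁, v₂} with hΛ
  have hbij := bijective_coneBox_quotient h11 h12 h21 h22
  have hper : ∀ w ∈ Λ, ∀ z, f (z + w) = f z := by
    intro w hw
    induction hw using AddSubgroup.closure_induction with
    | mem x hx =>
      rcases hx with rfl | rfl
      · exact hf₁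
      · exact hf₂
    | zero => simp
    | add x y _ _ hx hy => intro z; rw [← add_assoc, hy, hx]
    | neg x _ hx => intro z; rw [← hx (z + -x), neg_add_cancel_right]
  let F : A ⧸ Λ → ℂ := Quotient.lift f (fun z w h => by
    have h1 := QuotientAddGroup.leftRel_apply.mp h
    rw [← hper _ h1 z, add_neg_cancel_left])
  have hF : ∀ z : A, F (z : A ⧸ Λ) = f z := fun z => rfl
  let e := Equiv.ofBijective _ hbij
  have : Fintype (A ⧸ Λ) := Fintype.ofEquiv _ e
  have h1 : ∑ z : coneBox t₁ t₂, f z = ∑ x : A ⧸ Λ, F x := by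
    rw [← e.sum_comp]
    rfl
  obtain ⟨ν, hν, hfν⟩ := hf (Nat.card (A ⧸ Λ)) Nat.card_pos.ne'
  have h2 : ∑ x : A ⧸ Λ, F x = ε * ∑ x : A ⧸ Λ, F x := by
    rw [Finset.mul_sum, ← (Nat.Coprime.nsmul_right_bijective hν).sum_comp]
    refine Finset.sum_congr rfl fun x _ => ?_
    obtain ⟨z, rfl⟩ := QuotientAddGroup.mk_surjective x
    rw [hF, ← hfν]
    rfl
  rw [h1]
  have h3 : (1 - ε) * ∑ x : A ⧸ Λ, F x = 0 := by linear_combination h2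
  exact (mul_eq_zero.mp h3).resolve_left (sub_ne_zero.mpr hε.symm)

lemma exists_norm_tsum_coneSet_le (h11 : t₁ v₁ = 1) (h12 : t₁ v₂ = 0) (h21 : t₂ v₁ = 0)
    (h22 : t₂ v₂ = 1) (hfin : (coneBox t₁ t₂).Finite) (f : A → ℂ) (hf₁ : ∀ z, f (z + v₁) = f z)
    (hf₂ : ∀ z, f (z + v₂) = f z) (ε : ℂ) (hε : ε ≠ 1)
    (hf : ∀ c : ℕ, c ≠ 0 → ∃ ν : ℕ, c.Coprime ν ∧ ∀ z, f (ν • z) = ε * f z)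
    {p p' : ℝ} (hp : 0 < p) (hp' : 0 < p') :
    (∀ s : ℝ, 1 < s → Summable fun z : coneSet t₁ t₂ => coneForm p p' (t₁ z) (t₂ z) ^ (-s)) ∧
    ∃ B : ℝ, ∀ s : ℝ, 1 < s → s < 2 → ‖∑' z : coneSet t₁ t₂,
      f z * ((coneForm p p' (t₁ z) (t₂ z) ^ (-s) : ℝ) : ℂ)‖ ≤ B := by
  have := hfin.fintype
  have ht₁ : ∀ (z : A) (a b : ℕ), t₁ (z + (a • v₁ + b • v₂)) = t₁ z + a := by
    intro z a b; simp [h11, h12]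
  have ht₂ : ∀ (z : A) (a b : ℕ), t₂ (z + (a • v₁ + b • v₂)) = t₂ z + b := by
    intro z a b; simp [h21, h22]
  have hper : ∀ (z : A) (a b : ℕ), f (z + (a • v₁ + b • v₂)) = f z := by
    intro z a b
    rw [← add_assoc]
    have h1 : ∀ (a : ℕ) z, f (z + a • v₁) = f z := by
      intro a
      induction a with
      | zero => simp
      | succ a ih => intro z; rw [succ_nsmul, ← add_assoc, hf₁, ih]
    have h2 : ∀ (b : ℕ) z, f (z + b • v₂) = f z := by
      intro b
      induction b with
      | zero => simp
      | succ a ih => intro z; rw [succ_nsmul, ← add_assoc, hf₂, ih]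
    rw [h2, h1]
  let φ : coneBox t₁ t₂ × ℕ × ℕ → coneSet t₁ t₂ := fun x =>
    ⟨x.1 + (x.2.1 • v₁ + x.2.2 • v₂), by
      obtain ⟨⟨z, hz⟩, a, b⟩ := x
      show 0 < t₁ _ ∧ 0 ≤ t₂ _
      rw [ht₁, ht₂]
      have ha : (0 : ℝ) ≤ a := Nat.cast_nonneg _
      have hb : (0 : ℝ) ≤ b := Nat.cast_nonneg _
      exact ⟨add_pos_of_pos_of_nonneg hz.1.1 ha, add_nonneg hz.2.1 hb⟩⟩
  have hφ : Function.Bijective φ := by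
    constructor
    · rintro ⟨⟨z, hz⟩, a, b⟩ ⟨⟨w, hw⟩, a', b'⟩ h
      have h : z + (a • v₁ + b • v₂) = w + (a' • v₁ + b' • v₂) := congrArg Subtype.val h
      have h1 := (exists_unique_add_mem_coneBox h11 h12 h21 h22 (z + (a • v₁ + b • v₂))).unique
        (y₁ := ((a : ℤ), (b : ℤ))) (y₂ := ((a' : ℤ), (b' : ℤ))) (by simpa using hz)
        (by rw [h]; simpa using hw)
      simp only [Prod.mk.injEq, Nat.cast_inj] at h1
      obtain ⟨rfl, rfl⟩ := h1
      simpa using h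
    · rintro ⟨z, hz1, hz2⟩
      obtain ⟨⟨a, b⟩, hab, -⟩ := exists_unique_add_mem_coneBox h11 h12 h21 h22 z
      have hab' := hab
      simp only [coneBox, Set.mem_ofPred_eq, map_sub, map_add, map_zsmul, h11, h12, h21, h22,
        smul_zero, add_zero, zero_add, zsmul_eq_mul, mul_one] at hab'
      have ha : 0 ≤ a := by
        have : (-1 : ℝ) < a := by linarith [hab'.1.2]
        have : (-1 : ℤ) < a := by exact_mod_cast this
        omega
      have hb : 0 ≤ b := by
        have : (-1 : ℝ) < b := by linarith [hab'.2.2]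
        have : (-1 : ℤ) < b := by exact_mod_cast this
        omega
      obtain ⟨a, rfl⟩ := Int.eq_ofNat_of_zero_le ha
      obtain ⟨b, rfl⟩ := Int.eq_ofNat_of_zero_le hb
      refine ⟨(⟨_, hab⟩, a, b), Subtype.ext ?_⟩
      simp [φ]
  let e := Equiv.ofBijective φ hφ
  have he₁ : ∀ x, t₁ (e x) = t₁ x.1 + x.2.1 := fun x => ht₁ _ _ _
  have he₂ : ∀ x, t₂ (e x) = t₂ x.1 + x.2.2 := fun x => ht₂ _ _ _
  have hef : ∀ x, f (e x) = f x.1 := fun x => hper _ _ _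
  constructor
  · intro s hs
    rw [← e.summable_iff]
    refine (summable_coneForm (Z := coneBox t₁ t₂) (τ₁ := fun z => t₁ z) (τ₂ := fun z => t₂ z)
      (fun z => z.2.1.1) (fun z => z.2.2.1) hp hp' hs).congr fun x => ?_
    simp [he₁, he₂]
  · obtain ⟨B, hB⟩ := exists_norm_tsum_coneForm_le (Z := coneBox t₁ t₂) (τ₁ := fun z => t₁ z)
      (τ₂ := fun z => t₂ z) (fun z => z.2.1) (fun z => z.2.2) hp hp' (fun z => f z)
      (sum_coneBox_eq_zero h11 h12 h21 h22 f hf₁ hf₂ ε hε hf)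
    refine ⟨B, fun s hs hs2 => ?_⟩
    rw [← e.tsum_eq]
    simp_rw [he₁, he₂, hef]
    exact hB s hs hs2

end LatticeCone

section RealQuadratic

variable {F : Type*} [Field F] [NumberField F]

/-- `σ₁, σ₂` are the two embeddings of a real quadratic field. -/
structure IsRealPair (σ₁ σ₂ : F →+* ℝ) : Prop where
  ne : σ₁ ≠ σ₂
  finrank_eq : finrank ℚ F = 2

namespace IsRealPair

variable {σ₁ σ₂ : F →+* ℝ} (h : IsRealPair σ₁ σ₂)
include h

lemma ofReal_comp_ne : (Complex.ofRealHom.comp σ₁) ≠ (Complex.ofRealHom.comp σ₂) := fun h1 =>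
  h.ne (RingHom.ext fun x => Complex.ofReal_injective (RingHom.congr_fun h1 x))

open Classical in
lemma univ_eq : (Finset.univ : Finset (F →+* ℂ)) =
    {Complex.ofRealHom.comp σ₁, Complex.ofRealHom.comp σ₂} := by
  refine (Finset.eq_of_subset_of_card_le (Finset.subset_univ _) ?_).symm
  rw [Finset.card_pair h.ofReal_comp_ne, Finset.card_univ, Embeddings.card, h.finrank_eq]

lemma eq_or_eq (φ : F →+* ℂ) :
    φ = Complex.ofRealHom.comp σ₁ ∨ φ = Complex.ofRealHom.comp σ₂ := by
  classical
  have := Finset.mem_univ φ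
  rw [h.univ_eq] at this
  simpa using this

lemma norm_eq (x : F) : ((Algebra.norm ℚ x : ℚ) : ℝ) = σ₁ x * σ₂ x := by
  classical
  have h1 := Algebra.norm_eq_prod_embeddings ℚ ℂ x
  rw [← (RingHom.equivRatAlgHom (R := F) (S := ℂ)).prod_comp, h.univ_eq,
    Finset.prod_pair h.ofReal_comp_ne] at h1
  apply Complex.ofReal_injective
  rw [Complex.ofReal_mul]
  simpa using h1

lemma norm_int_eq (x : 𝓞 F) : ((Algebra.norm ℤ x : ℤ) : ℝ) = σ₁ x * σ₂ x := by
  rw [← h.norm_eq, ← Algebra.coe_norm_int]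
  simp

lemma norm_int_add_smul (z w : 𝓞 F) (k : ℕ) : Algebra.norm ℤ (z + k • w) = Algebra.norm ℤ z +
    k * (Algebra.norm ℤ (z + w) - Algebra.norm ℤ z - Algebra.norm ℤ w + k * Algebra.norm ℤ w) := by
  have : ((Algebra.norm ℤ (z + k • w) : ℤ) : ℝ) = ((Algebra.norm ℤ z + k * (Algebra.norm ℤ (z + w) -
      Algebra.norm ℤ z - Algebra.norm ℤ w + k * Algebra.norm ℤ w) : ℤ) : ℝ) := by
    push_cast
    simp only [h.norm_int_eq]
    simp
    ring
  exact_mod_cast this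

lemma exists_unit : ∃ η : (𝓞 F)ˣ, 0 < σ₂ (η : 𝓞 F) ∧ σ₂ (η : 𝓞 F) < σ₁ (η : 𝓞 F) ∧
    σ₁ (η : 𝓞 F) * σ₂ (η : 𝓞 F) = 1 := by
  obtain ⟨u, hu⟩ := Units.dirichletUnitTheorem.exists_unit F
    (InfinitePlace.mk (Complex.ofRealHom.comp σ₁))
  have h1 := hu (InfinitePlace.mk (Complex.ofRealHom.comp σ₂)) (by
    rw [Ne, InfinitePlace.mk_eq_iff, not_or]
    refine ⟨h.ofReal_comp_ne.symm, fun h1 => h.ofReal_comp_ne.symm ?_⟩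
    rw [← h1]
    ext x
    simp [ComplexEmbedding.conjugate_coe_eq])
  rw [InfinitePlace.apply] at h1
  have h2 : |σ₁ (u : 𝓞 F)| * |σ₂ (u : 𝓞 F)| = 1 := by
    rw [← abs_mul, ← h.norm_int_eq, ← Int.cast_abs]
    rw [Int.isUnit_iff_abs_eq.mp (u.isUnit.map (Algebra.norm ℤ)), Int.cast_one]
  have h3 : |σ₂ (u : 𝓞 F)| < 1 := by
    have h4 : 0 < |σ₂ (u : 𝓞 F)| := by
      rcases (abs_nonneg (σ₂ (u : 𝓞 F))).eq_or_lt with h4 | h4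
      · rw [← h4, mul_zero] at h2; exact absurd h2 zero_ne_one
      · exact h4
    rw [← Real.log_neg_iff h4]
    simpa using h1
  refine ⟨u ^ 2, ?_, ?_, ?_⟩
  all_goals simp only [Units.val_pow_eq_pow_val, map_pow]
  · have : σ₂ (u : 𝓞 F) ≠ 0 := by
      intro h4; rw [h4, abs_zero, mul_zero] at h2; exact absurd h2 zero_ne_one
    positivity
  · rw [sq_lt_sq]
    nlinarith [abs_nonneg (σ₂ (u : 𝓞 F)), abs_nonneg (σ₁ (u : 𝓞 F))]
  · rw [← sq_abs (σ₁ _), ← sq_abs (σ₂ _), ← mul_pow, h2, one_pow]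

end IsRealPair

/-- The first coordinate with respect to `kθ, kηθ`. -/
def coneCoord₁ (σ₁ σ₂ : F →+* ℝ) (η : (𝓞 F)ˣ) (𝔟 : Ideal (𝓞 F)) (θ : 𝔟) (k : ℕ) : 𝔟 →+ ℝ where
  toFun z := (σ₁ (η : 𝓞 F) * (σ₂ (z : 𝓞 F) / σ₂ (θ : 𝓞 F)) -
    σ₂ (η : 𝓞 F) * (σ₁ (z : 𝓞 F) / σ₁ (θ : 𝓞 F))) / (k * (σ₁ (η : 𝓞 F) - σ₂ (η : 𝓞 F)))
  map_zero' := by simp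
  map_add' z w := by
    simp only [Submodule.coe_add, map_add]
    ring

/-- The second coordinate with respect to `kθ, kηθ`. -/
def coneCoord₂ (σ₁ σ₂ : F →+* ℝ) (η : (𝓞 F)ˣ) (𝔟 : Ideal (𝓞 F)) (θ : 𝔟) (k : ℕ) : 𝔟 →+ ℝ where
  toFun z := (σ₁ (z : 𝓞 F) / σ₁ (θ : 𝓞 F) - σ₂ (z : 𝓞 F) / σ₂ (θ : 𝓞 F)) /
    (k * (σ₁ (η : 𝓞 F) - σ₂ (η : 𝓞 F)))
  map_zero' := by simp
  map_add' z w := by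
    simp only [Submodule.coe_add, map_add]
    ring

variable {σ₁ σ₂ : F →+* ℝ} {η : (𝓞 F)ˣ} {𝔟 : Ideal (𝓞 F)} {θ : 𝔟} {k : ℕ}

lemma coneCoord_decomp₁ (hη : σ₂ (η : 𝓞 F) < σ₁ (η : 𝓞 F)) (hk : 0 < k) (z : 𝔟) :
    σ₁ (z : 𝓞 F) / σ₁ (θ : 𝓞 F) = k * (coneCoord₁ σ₁ σ₂ η 𝔟 θ k z +
      σ₁ (η : 𝓞 F) * coneCoord₂ σ₁ σ₂ η 𝔟 θ k z) := by
  have h1 : σ₁ (η : 𝓞 F) - σ₂ (η : 𝓞 F) ≠ 0 := (sub_pos.mpr hη).ne'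
  have h2 : (k : ℝ) ≠ 0 := Nat.cast_ne_zero.mpr hk.ne'
  simp only [coneCoord₁, coneCoord₂, AddMonoidHom.coe_mk, ZeroHom.coe_mk]
  generalize σ₁ (z : 𝓞 F) / σ₁ (θ : 𝓞 F) = x
  generalize σ₂ (z : 𝓞 F) / σ₂ (θ : 𝓞 F) = y
  field_simp
  ring

lemma coneCoord_decomp₂ (hη : σ₂ (η : 𝓞 F) < σ₁ (η : 𝓞 F)) (hk : 0 < k) (z : 𝔟) :
    σ₂ (z : 𝓞 F) / σ₂ (θ : 𝓞 F) = k * (coneCoord₁ σ₁ σ₂ η 𝔟 θ k z +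
      σ₂ (η : 𝓞 F) * coneCoord₂ σ₁ σ₂ η 𝔟 θ k z) := by
  have h1 : σ₁ (η : 𝓞 F) - σ₂ (η : 𝓞 F) ≠ 0 := (sub_pos.mpr hη).ne'
  have h2 : (k : ℝ) ≠ 0 := Nat.cast_ne_zero.mpr hk.ne'
  simp only [coneCoord₁, coneCoord₂, AddMonoidHom.coe_mk, ZeroHom.coe_mk]
  generalize σ₁ (z : 𝓞 F) / σ₁ (θ : 𝓞 F) = x
  generalize σ₂ (z : 𝓞 F) / σ₂ (θ : 𝓞 F) = y
  field_simp
  ring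

lemma mem_coneSet_iff (hη : σ₂ (η : 𝓞 F) < σ₁ (η : 𝓞 F)) (hk : 0 < k) (z : 𝔟) :
    z ∈ coneSet (coneCoord₁ σ₁ σ₂ η 𝔟 θ k) (coneCoord₂ σ₁ σ₂ η 𝔟 θ k) ↔
      σ₂ (z : 𝓞 F) / σ₂ (θ : 𝓞 F) ≤ σ₁ (z : 𝓞 F) / σ₁ (θ : 𝓞 F) ∧
      σ₂ (η : 𝓞 F) * (σ₁ (z : 𝓞 F) / σ₁ (θ : 𝓞 F)) <
        σ₁ (η : 𝓞 F) * (σ₂ (z : 𝓞 F) / σ₂ (θ : 𝓞 F)) := by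
  have h1 : 0 < k * (σ₁ (η : 𝓞 F) - σ₂ (η : 𝓞 F)) :=
    mul_pos (Nat.cast_pos.mpr hk) (sub_pos.mpr hη)
  rw [coneSet, Set.mem_ofPred_eq, coneCoord₁, coneCoord₂]
  simp only [AddMonoidHom.coe_mk, ZeroHom.coe_mk]
  rw [div_pos_iff_of_pos_right h1, le_div_iff₀ h1, zero_mul, sub_pos, sub_nonneg, and_comm]

lemma coneBox_finite (h : IsRealPair σ₁ σ₂) (hη0 : 0 < σ₂ (η : 𝓞 F))
    (hη : σ₂ (η : 𝓞 F) < σ₁ (η : 𝓞 F)) (hk : 0 < k) (hθ : (θ : 𝓞 F) ≠ 0) :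
    (coneBox (coneCoord₁ σ₁ σ₂ η 𝔟 θ k) (coneCoord₂ σ₁ σ₂ η 𝔟 θ k)).Finite := by
  have hθ' : ((θ : 𝓞 F) : F) ≠ 0 := by simpa using hθ
  have hθ₁ : σ₁ (θ : 𝓞 F) ≠ 0 := (map_ne_zero σ₁).mpr hθ'
  have hθ₂ : σ₂ (θ : 𝓞 F) ≠ 0 := (map_ne_zero σ₂).mpr hθ'
  set B₁ : ℝ := k * (1 + σ₁ (η : 𝓞 F)) * |σ₁ (θ : 𝓞 F)|
  set B₂ : ℝ := k * (1 + σ₁ (η : 𝓞 F)) * |σ₂ (θ : 𝓞 F)|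
  have hinj : Function.Injective fun z : 𝔟 => ((z : 𝓞 F) : F) := fun z w hzw =>
    Subtype.ext (RingOfIntegers.ext hzw)
  refine ((Embeddings.finite_of_norm_le F ℂ (max B₁ B₂)).preimage hinj.injOn).subset ?_
  rintro z ⟨⟨h1, h2⟩, h3, h4⟩
  have e1 : σ₁ (z : 𝓞 F) = _ * σ₁ (θ : 𝓞 F) :=
    (div_eq_iff hθ₁).mp (coneCoord_decomp₁ (θ := θ) hη hk z)
  have e2 : σ₂ (z : 𝓞 F) = _ * σ₂ (θ : 𝓞 F) :=
    (div_eq_iff hθ₂).mp (coneCoord_decomp₂ (θ := θ) hη hk z)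
  generalize coneCoord₁ σ₁ σ₂ η 𝔟 θ k z = t₁ at *
  generalize coneCoord₂ σ₁ σ₂ η 𝔟 θ k z = t₂ at *
  have hk' : (0 : ℝ) < k := Nat.cast_pos.mpr hk
  have e3 : ∀ p : ℝ, 0 < p → p ≤ σ₁ (η : 𝓞 F) → |k * (t₁ + p * t₂)| ≤
      k * (1 + σ₁ (η : 𝓞 F)) := by
    intro p hp hp'
    rw [abs_of_nonneg (by positivity)]
    have : p * t₂ ≤ σ₁ (η : 𝓞 F) * 1 := mul_le_mul hp' h4.le h3 (hp.le.trans hp')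
    gcongr
    linarith
  refine ⟨RingOfIntegers.isIntegral_coe _, fun φ => ?_⟩
  rcases h.eq_or_eq φ with rfl | rfl
  · refine le_trans ?_ (le_max_left _ _)
    simp only [RingHom.comp_apply, Complex.ofRealHom_eq_coe, Complex.norm_real, Real.norm_eq_abs]
    rw [e1, abs_mul]
    exact mul_le_mul_of_nonneg_right (e3 _ (hη0.trans hη) le_rfl) (abs_nonneg _)
  · refine le_trans ?_ (le_max_right _ _)
    simp only [RingHom.comp_apply, Complex.ofRealHom_eq_coe, Complex.norm_real, Real.norm_eq_abs]
    rw [e2, abs_mul]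
    exact mul_le_mul_of_nonneg_right (e3 _ hη0 hη.le) (abs_nonneg _)

/-- The absolute norm of the integral ideal `z𝔟⁻¹`, for `z ∈ 𝔟`. -/
def relAbsNorm (𝔟 : Ideal (𝓞 F)) (z : 𝔟) : ℕ := (Algebra.norm ℤ (z : 𝓞 F)).natAbs / Ideal.absNorm 𝔟

lemma absNorm_dvd_norm (z : 𝔟) : (Ideal.absNorm 𝔟 : ℤ) ∣ Algebra.norm ℤ (z : 𝓞 F) :=
  Ideal.absNorm_dvd_norm_of_mem z.2

lemma absNorm_mul_relAbsNorm (𝔟 : Ideal (𝓞 F)) (z : 𝔟) :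
    Ideal.absNorm 𝔟 * relAbsNorm 𝔟 z = (Algebra.norm ℤ (z : 𝓞 F)).natAbs :=
  Nat.mul_div_cancel' (Int.natCast_dvd.mp (absNorm_dvd_norm z))

lemma relAbsNorm_eq_coneForm (h : IsRealPair σ₁ σ₂) (h𝔟 : 𝔟 ≠ ⊥)
    (hη : σ₂ (η : 𝓞 F) < σ₁ (η : 𝓞 F)) (hη0 : 0 < σ₂ (η : 𝓞 F)) (hk : 0 < k)
    (hθ : (θ : 𝓞 F) ≠ 0) {z : 𝔟}
    (hz : z ∈ coneSet (coneCoord₁ σ₁ σ₂ η 𝔟 θ k) (coneCoord₂ σ₁ σ₂ η 𝔟 θ k)) :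
    (relAbsNorm 𝔟 z : ℝ) = |(Algebra.norm ℤ (θ : 𝓞 F) : ℝ)| * k ^ 2 / Ideal.absNorm 𝔟 *
      coneForm (σ₁ (η : 𝓞 F)) (σ₂ (η : 𝓞 F)) (coneCoord₁ σ₁ σ₂ η 𝔟 θ k z)
        (coneCoord₂ σ₁ σ₂ η 𝔟 θ k z) ∧
    0 < (Algebra.norm ℤ (z : 𝓞 F) : ℝ) / (Algebra.norm ℤ (θ : 𝓞 F) : ℝ) ∧
    0 < σ₁ (z : 𝓞 F) / σ₁ (θ : 𝓞 F) ∧ 0 < σ₂ (z : 𝓞 F) / σ₂ (θ : 𝓞 F) := by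
  have hθ' : ((θ : 𝓞 F) : F) ≠ 0 := by simpa using hθ
  have hθ₁ : σ₁ (θ : 𝓞 F) ≠ 0 := (map_ne_zero σ₁).mpr hθ'
  have hθ₂ : σ₂ (θ : 𝓞 F) ≠ 0 := (map_ne_zero σ₂).mpr hθ'
  have hb : (Ideal.absNorm 𝔟 : ℝ) ≠ 0 := by
    simpa [Ideal.absNorm_eq_zero_iff] using h𝔟
  have hk' : (0 : ℝ) < k := Nat.cast_pos.mpr hk
  obtain ⟨h1, h2⟩ := hz
  have e1 := coneCoord_decomp₁ (θ := θ) hη hk z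
  have e2 := coneCoord_decomp₂ (θ := θ) hη hk z
  have e1' : 0 < σ₁ (z : 𝓞 F) / σ₁ (θ : 𝓞 F) := by
    rw [e1]
    exact mul_pos hk' (add_pos_of_pos_of_nonneg h1 (mul_nonneg (hη0.trans hη).le h2))
  have e2' : 0 < σ₂ (z : 𝓞 F) / σ₂ (θ : 𝓞 F) := by
    rw [e2]
    exact mul_pos hk' (add_pos_of_pos_of_nonneg h1 (mul_nonneg hη0.le h2))
  have e3 : (Algebra.norm ℤ (z : 𝓞 F) : ℝ) / (Algebra.norm ℤ (θ : 𝓞 F) : ℝ) =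
      σ₁ (z : 𝓞 F) / σ₁ (θ : 𝓞 F) * (σ₂ (z : 𝓞 F) / σ₂ (θ : 𝓞 F)) := by
    rw [h.norm_int_eq, h.norm_int_eq, mul_div_mul_comm]
  have e4 := mul_pos e1' e2'
  refine ⟨?_, by rw [e3]; exact e4, e1', e2'⟩
  have e5 : (Ideal.absNorm 𝔟 : ℝ) * relAbsNorm 𝔟 z = |(Algebra.norm ℤ (z : 𝓞 F) : ℝ)| := by
    rw [← Nat.cast_mul, absNorm_mul_relAbsNorm, Nat.cast_natAbs, Int.cast_abs]
  have hθN : (Algebra.norm ℤ (θ : 𝓞 F) : ℝ) ≠ 0 := by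
    rw [h.norm_int_eq]; exact mul_ne_zero hθ₁ hθ₂
  have e6 : |(Algebra.norm ℤ (z : 𝓞 F) : ℝ)| = |(Algebra.norm ℤ (θ : 𝓞 F) : ℝ)| *
      (σ₁ (z : 𝓞 F) / σ₁ (θ : 𝓞 F) * (σ₂ (z : 𝓞 F) / σ₂ (θ : 𝓞 F))) := by
    rw [← abs_of_pos e4, ← abs_mul, ← e3, mul_div_cancel₀ _ hθN]
  rw [e6, e1, e2] at e5
  rw [coneForm]
  field_simp
  linear_combination e5

/-- For `z ∈ 𝔟`, the value of a Dirichlet character at the signed norm of `z𝔟⁻¹`. -/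
def signedCharNorm {n : ℕ} (ψ : DirichletCharacter ℂ n) (𝔟 : Ideal (𝓞 F)) (δ : ℤ) (z : 𝔟) : ℂ :=
  ψ ((δ * (Algebra.norm ℤ (z : 𝓞 F) / Ideal.absNorm 𝔟) : ℤ) : ZMod n)

lemma signedCharNorm_add (h : IsRealPair σ₁ σ₂) {n : ℕ} (ψ : DirichletCharacter ℂ n)
    (h𝔟 : 𝔟 ≠ ⊥) (δ : ℤ) (z w : 𝔟) :
    signedCharNorm ψ 𝔟 δ (z + (n * Ideal.absNorm 𝔟) • w) = signedCharNorm ψ 𝔟 δ z := by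
  have hb : (Ideal.absNorm 𝔟 : ℤ) ≠ 0 := by
    simpa [Ideal.absNorm_eq_zero_iff] using h𝔟
  have h1 := h.norm_int_add_smul z w (n * Ideal.absNorm 𝔟)
  rw [signedCharNorm, signedCharNorm]
  congr 1
  obtain ⟨c, hc⟩ := absNorm_dvd_norm z
  have h2 : ((z + (n * Ideal.absNorm 𝔟) • w : 𝔟) : 𝓞 F) =
    (z : 𝓞 F) + (n * Ideal.absNorm 𝔟) • (w : 𝓞 F) := by simp
  rw [h2, h1]
  rw [show ∀ X : ℤ, Algebra.norm ℤ (z : 𝓞 F) + ((n * Ideal.absNorm 𝔟 : ℕ) : ℤ) * X =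
    Ideal.absNorm 𝔟 * (c + n * X) from fun X => by rw [hc]; push_cast; ring, hc,
    Int.mul_ediv_cancel_left _ hb, Int.mul_ediv_cancel_left _ hb]
  push_cast
  simp

lemma signedCharNorm_smul (h : IsRealPair σ₁ σ₂) {n : ℕ} (ψ : DirichletCharacter ℂ n)
    (h𝔟 : 𝔟 ≠ ⊥) (δ : ℤ) (z : 𝔟) (ν : ℕ) :
    signedCharNorm ψ 𝔟 δ (ν • z) = ψ (ν : ZMod n) ^ 2 * signedCharNorm ψ 𝔟 δ z := by
  have hb : (Ideal.absNorm 𝔟 : ℤ) ≠ 0 := by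
    simpa [Ideal.absNorm_eq_zero_iff] using h𝔟
  obtain ⟨c, hc⟩ := absNorm_dvd_norm z
  have h2 : Algebra.norm ℤ ((ν • z : 𝔟) : 𝓞 F) = Ideal.absNorm 𝔟 * (ν ^ 2 * c) := by
    have : ((Algebra.norm ℤ ((ν • z : 𝔟) : 𝓞 F) : ℤ) : ℝ) =
        ((ν ^ 2 * Algebra.norm ℤ (z : 𝓞 F) : ℤ) : ℝ) := by
      push_cast
      rw [h.norm_int_eq, h.norm_int_eq]
      simp
      ring
    rw [show Algebra.norm ℤ ((ν • z : 𝔟) : 𝓞 F) = ν ^ 2 * Algebra.norm ℤ (z : 𝓞 F) by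
      exact_mod_cast this, hc]
    ring
  rw [signedCharNorm, signedCharNorm, h2, hc, Int.mul_ediv_cancel_left _ hb,
    Int.mul_ediv_cancel_left _ hb, ← map_pow, ← map_mul]
  congr 1
  push_cast
  ring

lemma cast_relAbsNorm_eq (h𝔟 : 𝔟 ≠ ⊥) {n : ℕ} (ψ : DirichletCharacter ℂ n) {θ z : 𝔟}
    (hz : 0 < (Algebra.norm ℤ (z : 𝓞 F) : ℝ) / (Algebra.norm ℤ (θ : 𝓞 F) : ℝ)) :
    ψ (relAbsNorm 𝔟 z : ZMod n) = signedCharNorm ψ 𝔟 (Int.sign (Algebra.norm ℤ (θ : 𝓞 F))) z := by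
  have hb : (Ideal.absNorm 𝔟 : ℤ) ≠ 0 := by
    simpa [Ideal.absNorm_eq_zero_iff] using h𝔟
  have h1 : (Algebra.norm ℤ (z : 𝓞 F)).sign = (Algebra.norm ℤ (θ : 𝓞 F)).sign := by
    rcases div_pos_iff.mp hz with ⟨h1, h2⟩ | ⟨h1, h2⟩
    · rw [Int.sign_eq_one_of_pos (by exact_mod_cast h1),
        Int.sign_eq_one_of_pos (by exact_mod_cast h2)]
    · rw [Int.sign_eq_neg_one_of_neg (by exact_mod_cast h1),
        Int.sign_eq_neg_one_of_neg (by exact_mod_cast h2)]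
  rw [signedCharNorm]
  congr 1
  rw [← Int.cast_natCast]
  congr 1
  obtain ⟨c, hc⟩ := absNorm_dvd_norm z
  have h2 := absNorm_mul_relAbsNorm 𝔟 z
  apply mul_left_cancel₀ hb
  rw [← Nat.cast_mul, h2, ← h1, hc, Int.mul_ediv_cancel_left _ hb, mul_left_comm, ← hc,
    Int.sign_mul_self_eq_natAbs]

lemma exists_coprime_nat_map_eq {n : ℕ} [NeZero n] (a : (ZMod n)ˣ) (c : ℕ) (hc : c ≠ 0) :
    ∃ ν : ℕ, c.Coprime ν ∧ (ν : ZMod n) = a := by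
  have : NeZero (n * c) := ⟨mul_ne_zero (NeZero.ne n) hc⟩
  obtain ⟨b, hb⟩ := ZMod.unitsMap_surjective (dvd_mul_right n c) a
  refine ⟨(b : ZMod (n * c)).val, ?_, ?_⟩
  · exact (Nat.Coprime.coprime_mul_left_right (ZMod.val_coe_unit_coprime b)).symm
  · rw [← hb, ZMod.unitsMap_val, ZMod.cast_eq_val]

lemma exists_norm_tsum_quadrant_le (h : IsRealPair σ₁ σ₂) (h𝔟 : 𝔟 ≠ ⊥)
    (hη0 : 0 < σ₂ (η : 𝓞 F)) (hη : σ₂ (η : 𝓞 F) < σ₁ (η : 𝓞 F))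
    (hθ : (θ : 𝓞 F) ≠ 0) {n : ℕ} [NeZero n] (ψ : DirichletCharacter ℂ n)
    (hk : k = n * Ideal.absNorm 𝔟) (a : (ZMod n)ˣ) (ha : ψ a ^ 2 ≠ 1) :
    (∀ s : ℝ, 1 < s → Summable
      fun z : coneSet (coneCoord₁ σ₁ σ₂ η 𝔟 θ k) (coneCoord₂ σ₁ σ₂ η 𝔟 θ k) =>
        (relAbsNorm 𝔟 (z : 𝔟) : ℝ) ^ (-s)) ∧
    ∃ B : ℝ, ∀ s : ℝ, 1 < s → s < 2 →
      ‖∑' z : coneSet (coneCoord₁ σ₁ σ₂ η 𝔟 θ k) (coneCoord₂ σ₁ σ₂ η 𝔟 θ k),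
        ψ (relAbsNorm 𝔟 (z : 𝔟) : ZMod n) * (((relAbsNorm 𝔟 (z : 𝔟) : ℝ) ^ (-s) : ℝ) : ℂ)‖ ≤ B := by
  have hb : 0 < Ideal.absNorm 𝔟 := by
    rw [Nat.pos_iff_ne_zero, Ne, Ideal.absNorm_eq_zero_iff]; exact h𝔟
  have hk0 : 0 < k := by rw [hk]; exact mul_pos (NeZero.pos n) hb
  have hk' : (0 : ℝ) < k := Nat.cast_pos.mpr hk0
  have hθ' : ((θ : 𝓞 F) : F) ≠ 0 := by simpa using hθ
  have hθ₁ : σ₁ (θ : 𝓞 F) ≠ 0 := (map_ne_zero σ₁).mpr hθ'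
  have hθ₂ : σ₂ (θ : 𝓞 F) ≠ 0 := (map_ne_zero σ₂).mpr hθ'
  have hη' : σ₁ (η : 𝓞 F) - σ₂ (η : 𝓞 F) ≠ 0 := (sub_pos.mpr hη).ne'
  have hθN : (Algebra.norm ℤ (θ : 𝓞 F) : ℝ) ≠ 0 := by
    rw [h.norm_int_eq]; exact mul_ne_zero hθ₁ hθ₂
  let ηθ : 𝔟 := ⟨(η : 𝓞 F) * θ, 𝔟.mul_mem_left _ θ.2⟩
  have hcoe₁ : ∀ σ : F →+* ℝ, σ ((k • θ : 𝔟) : 𝓞 F) = k * σ (θ : 𝓞 F) := by intro σ; simp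
  have hcoe₂ : ∀ σ : F →+* ℝ, σ ((k • ηθ : 𝔟) : 𝓞 F) = k * (σ (η : 𝓞 F) * σ (θ : 𝓞 F)) := by
    intro σ; simp [ηθ]
  have h11 : coneCoord₁ σ₁ σ₂ η 𝔟 θ k (k • θ) = 1 := by
    simp only [coneCoord₁, AddMonoidHom.coe_mk, ZeroHom.coe_mk, hcoe₁]
    field_simp
  have h12 : coneCoord₁ σ₁ σ₂ η 𝔟 θ k (k • ηθ) = 0 := by
    simp only [coneCoord₁, AddMonoidHom.coe_mk, ZeroHom.coe_mk, hcoe₂]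
    field_simp
    ring
  have h21 : coneCoord₂ σ₁ σ₂ η 𝔟 θ k (k • θ) = 0 := by
    simp only [coneCoord₂, AddMonoidHom.coe_mk, ZeroHom.coe_mk, hcoe₁]
    field_simp
    ring
  have h22 : coneCoord₂ σ₁ σ₂ η 𝔟 θ k (k • ηθ) = 1 := by
    simp only [coneCoord₂, AddMonoidHom.coe_mk, ZeroHom.coe_mk, hcoe₂]
    field_simp
  set c : ℝ := |(Algebra.norm ℤ (θ : 𝓞 F) : ℝ)| * k ^ 2 / Ideal.absNorm 𝔟 with hc
  have hc0 : 0 < c := by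
    have : (0 : ℝ) < Ideal.absNorm 𝔟 := Nat.cast_pos.mpr hb
    positivity
  obtain ⟨hS, B, hB⟩ := exists_norm_tsum_coneSet_le h11 h12 h21 h22
    (coneBox_finite h hη0 hη hk0 hθ)
    (signedCharNorm ψ 𝔟 (Int.sign (Algebra.norm ℤ (θ : 𝓞 F))))
    (fun z => by rw [hk]; exact signedCharNorm_add h ψ h𝔟 _ z θ)
    (fun z => by rw [hk]; exact signedCharNorm_add h ψ h𝔟 _ z ηθ) (ψ a ^ 2) ha
    (fun c hc => by
      obtain ⟨ν, hν, hνa⟩ := exists_coprime_nat_map_eq a c hc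
      exact ⟨ν, hν, fun z => by rw [signedCharNorm_smul h ψ h𝔟, hνa]⟩) (hη0.trans hη) hη0
  have hterm : ∀ (s : ℝ)
      (z : coneSet (coneCoord₁ σ₁ σ₂ η 𝔟 θ k) (coneCoord₂ σ₁ σ₂ η 𝔟 θ k)),
      (relAbsNorm 𝔟 (z : 𝔟) : ℝ) ^ (-s) = c ^ (-s) *
        coneForm (σ₁ (η : 𝓞 F)) (σ₂ (η : 𝓞 F)) (coneCoord₁ σ₁ σ₂ η 𝔟 θ k z)
          (coneCoord₂ σ₁ σ₂ η 𝔟 θ k z) ^ (-s) := by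
    intro s z
    rw [(relAbsNorm_eq_coneForm h h𝔟 hη hη0 hk0 hθ z.2).1, Real.mul_rpow hc0.le]
    have h1 := z.2.1
    have h2 := z.2.2
    have h3 := hη0.trans hη
    rw [coneForm]
    positivity
  constructor
  · intro s hs
    simp_rw [hterm]
    exact (hS s hs).mul_left _
  · refine ⟨(c ^ (-1 : ℝ) + c ^ (-2 : ℝ)) * B, fun s hs hs2 => ?_⟩
    have h1 : ∀ z : coneSet (coneCoord₁ σ₁ σ₂ η 𝔟 θ k) (coneCoord₂ σ₁ σ₂ η 𝔟 θ k),
        ψ (relAbsNorm 𝔟 (z : 𝔟) : ZMod n) * (((relAbsNorm 𝔟 (z : 𝔟) : ℝ) ^ (-s) : ℝ) : ℂ) =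
        ((c ^ (-s) : ℝ) : ℂ) *
          (signedCharNorm ψ 𝔟 (Int.sign (Algebra.norm ℤ (θ : 𝓞 F))) z *
          ((coneForm (σ₁ (η : 𝓞 F)) (σ₂ (η : 𝓞 F)) (coneCoord₁ σ₁ σ₂ η 𝔟 θ k z)
          (coneCoord₂ σ₁ σ₂ η 𝔟 θ k z) ^ (-s) : ℝ) : ℂ)) := by
      intro z
      rw [hterm, cast_relAbsNorm_eq h𝔟 ψ (relAbsNorm_eq_coneForm h h𝔟 hη hη0 hk0 hθ z.2).2.1]
      push_cast
      ring
    rw [tsum_congr h1, tsum_mul_left, norm_mul, Complex.norm_real,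
      Real.norm_of_nonneg (by positivity)]
    refine mul_le_mul ?_ (hB s hs hs2) (norm_nonneg _) (by positivity)
    rcases le_total c 1 with h2 | h2
    · exact (Real.rpow_le_rpow_of_exponent_ge hc0 h2 (by linarith)).trans
        (le_add_of_nonneg_left (by positivity))
    · exact (Real.rpow_le_rpow_of_exponent_le h2 (by linarith)).trans
        (le_add_of_nonneg_right (by positivity))

/-- The fundamental cone, cut out by `θ` and the unit `η`. -/
abbrev unitCone (σ₁ σ₂ : F →+* ℝ) (η : (𝓞 F)ˣ) (𝔟 : Ideal (𝓞 F)) (k : ℕ) (θ : 𝔟) : Set 𝔟 :=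
  coneSet (coneCoord₁ σ₁ σ₂ η 𝔟 θ k) (coneCoord₂ σ₁ σ₂ η 𝔟 θ k)

lemma mem_unitCone_iff (hη : σ₂ (η : 𝓞 F) < σ₁ (η : 𝓞 F)) (hη0 : 0 < σ₂ (η : 𝓞 F)) (hk : 0 < k)
    {z : 𝔟} (h₂ : 0 < σ₂ (z : 𝓞 F) / σ₂ (θ : 𝓞 F)) :
    z ∈ unitCone σ₁ σ₂ η 𝔟 k θ ↔
      1 ≤ (σ₁ (z : 𝓞 F) / σ₁ (θ : 𝓞 F)) / (σ₂ (z : 𝓞 F) / σ₂ (θ : 𝓞 F)) ∧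
      (σ₁ (z : 𝓞 F) / σ₁ (θ : 𝓞 F)) / (σ₂ (z : 𝓞 F) / σ₂ (θ : 𝓞 F)) <
        σ₁ (η : 𝓞 F) / σ₂ (η : 𝓞 F) := by
  rw [unitCone, mem_coneSet_iff hη hk, one_le_div h₂, div_lt_div_iff₀ h₂ hη0,
    mul_comm (σ₂ (η : 𝓞 F))]

omit [NumberField F] in
lemma map_unit_smul (σ : F →+* ℝ) (u : (𝓞 F)ˣ) (z : 𝔟) :
    σ ((u • z : 𝔟) : 𝓞 F) = σ (u : 𝓞 F) * σ (z : 𝓞 F) := by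
  simp [Units.smul_def]

omit [NumberField F] in
lemma map_unit_zpow (σ : F →+* ℝ) (u : (𝓞 F)ˣ) (j : ℤ) :
    σ ((u ^ j : (𝓞 F)ˣ) : 𝓞 F) = σ (u : 𝓞 F) ^ j := by
  have h := congrArg Units.val
    (map_zpow (Units.map (σ.comp (algebraMap (𝓞 F) F) : (𝓞 F) →* ℝ)) u j)
  rw [Units.val_zpow_eq_zpow_val] at h
  exact h

omit [NumberField F] in
lemma unit_ratio_zpow_smul (u : (𝓞 F)ˣ) (j : ℤ) (z : 𝔟) :
    (σ₁ ((u ^ j • z : 𝔟) : 𝓞 F) / σ₁ (θ : 𝓞 F)) / (σ₂ ((u ^ j • z : 𝔟) : 𝓞 F) / σ₂ (θ : 𝓞 F)) =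
      (σ₁ (u : 𝓞 F) / σ₂ (u : 𝓞 F)) ^ j *
        ((σ₁ (z : 𝓞 F) / σ₁ (θ : 𝓞 F)) / (σ₂ (z : 𝓞 F) / σ₂ (θ : 𝓞 F))) := by
  rw [map_unit_smul, map_unit_smul, map_unit_zpow, map_unit_zpow, div_zpow]
  simp only [div_eq_mul_inv, mul_inv, inv_inv]
  ring

lemma exists_zpow_smul_mem_unitCone (hη : σ₂ (η : 𝓞 F) < σ₁ (η : 𝓞 F))
    (hη0 : 0 < σ₂ (η : 𝓞 F)) (hk : 0 < k) {z : 𝔟} (h₁ : 0 < σ₁ (z : 𝓞 F) / σ₁ (θ : 𝓞 F))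
    (h₂ : 0 < σ₂ (z : 𝓞 F) / σ₂ (θ : 𝓞 F)) :
    ∃ j : ℤ, η ^ j • z ∈ unitCone σ₁ σ₂ η 𝔟 k θ := by
  have hl : 1 < σ₁ (η : 𝓞 F) / σ₂ (η : 𝓞 F) := (one_lt_div hη0).mpr hη
  have hl0 := zero_lt_one.trans hl
  obtain ⟨i, hi⟩ := exists_mem_Ico_zpow (div_pos h₁ h₂) hl
  refine ⟨-i, ?_⟩
  have h3 : 0 < σ₂ ((η ^ (-i) • z : 𝔟) : 𝓞 F) / σ₂ (θ : 𝓞 F) := by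
    rw [map_unit_smul, map_unit_zpow, mul_div_assoc]
    exact mul_pos (zpow_pos hη0 _) h₂
  rw [mem_unitCone_iff hη hη0 hk h3, unit_ratio_zpow_smul, zpow_neg]
  have hp := zpow_pos hl0 i
  rw [inv_mul_eq_div, one_le_div hp, div_lt_iff₀ hp, mul_comm, ← zpow_add_one₀ hl0.ne']
  exact ⟨hi.1, hi.2⟩

lemma eq_zero_of_zpow_smul_mem_unitCone (hη : σ₂ (η : 𝓞 F) < σ₁ (η : 𝓞 F))
    (hη0 : 0 < σ₂ (η : 𝓞 F)) (hk : 0 < k) {z : 𝔟} {j : ℤ}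
    (h₁ : 0 < σ₁ (z : 𝓞 F) / σ₁ (θ : 𝓞 F))
    (h₂ : 0 < σ₂ (z : 𝓞 F) / σ₂ (θ : 𝓞 F)) (hz : z ∈ unitCone σ₁ σ₂ η 𝔟 k θ)
    (hjz : η ^ j • z ∈ unitCone σ₁ σ₂ η 𝔟 k θ) : j = 0 := by
  have hl : 1 < σ₁ (η : 𝓞 F) / σ₂ (η : 𝓞 F) := (one_lt_div hη0).mpr hη
  have hl0 := zero_lt_one.trans hl
  have h3 : 0 < σ₂ ((η ^ j • z : 𝔟) : 𝓞 F) / σ₂ (θ : 𝓞 F) := by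
    rw [map_unit_smul, map_unit_zpow, mul_div_assoc]
    exact mul_pos (zpow_pos hη0 _) h₂
  rw [mem_unitCone_iff hη hη0 hk h3, unit_ratio_zpow_smul] at hjz
  rw [mem_unitCone_iff hη hη0 hk h₂] at hz
  set l := σ₁ (η : 𝓞 F) / σ₂ (η : 𝓞 F)
  set r := (σ₁ (z : 𝓞 F) / σ₁ (θ : 𝓞 F)) / (σ₂ (z : 𝓞 F) / σ₂ (θ : 𝓞 F))
  have hr : 0 < r := div_pos h₁ h₂
  have hp := zpow_pos hl0 j
  have ha : l ^ j < l ^ (1 : ℤ) := by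
    rw [zpow_one]; nlinarith
  have hb : l ^ (-1 : ℤ) < l ^ j := by
    rw [zpow_neg_one, inv_lt_iff_one_lt_mul₀ hl0]; nlinarith
  rw [zpow_lt_zpow_iff_right₀ hl] at ha hb
  omega

/-- The pair of signs of the two real embeddings. -/
def signPair (σ₁ σ₂ : F →+* ℝ) (z : 𝔟) : SignType × SignType :=
  (SignType.sign (σ₁ (z : 𝓞 F)), SignType.sign (σ₂ (z : 𝓞 F)))

lemma sign_eq_iff_div_pos {x y : ℝ} (hy : y ≠ 0) (hx : x ≠ 0) :
    SignType.sign x = SignType.sign y ↔ 0 < x / y := by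
  rcases lt_or_gt_of_ne hx with h1 | h1 <;> rcases lt_or_gt_of_ne hy with h2 | h2 <;>
    simp [h1, h2, div_pos_iff, h1.not_gt, h2.not_gt]

omit [NumberField F] in
lemma map_coe_ne_zero (σ : F →+* ℝ) {z : 𝔟} (hz : z ≠ 0) : σ (z : 𝓞 F) ≠ 0 := by
  simpa using hz

omit [NumberField F] in
lemma signPair_eq_iff {z : 𝔟} (hz : z ≠ 0) (hθ : θ ≠ 0) :
    signPair σ₁ σ₂ z = signPair σ₁ σ₂ θ ↔
      0 < σ₁ (z : 𝓞 F) / σ₁ (θ : 𝓞 F) ∧ 0 < σ₂ (z : 𝓞 F) / σ₂ (θ : 𝓞 F) := by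
  rw [signPair, signPair, Prod.mk.injEq,
    sign_eq_iff_div_pos (map_coe_ne_zero _ hθ) (map_coe_ne_zero _ hz),
    sign_eq_iff_div_pos (map_coe_ne_zero _ hθ) (map_coe_ne_zero _ hz)]

lemma relAbsNorm_eq_absNorm (h𝔟 : 𝔟 ≠ ⊥) {z : 𝔟} {I : Ideal (𝓞 F)}
    (hz : Ideal.span {(z : 𝓞 F)} = I * 𝔟) : relAbsNorm 𝔟 z = Ideal.absNorm I := by
  have h1 := absNorm_mul_relAbsNorm 𝔟 z
  rw [← Ideal.absNorm_span_singleton, hz, map_mul, mul_comm] at h1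
  exact Nat.eq_of_mul_eq_mul_right
    (Nat.pos_of_ne_zero fun h => h𝔟 (Ideal.absNorm_eq_zero_iff.mp h)) h1

lemma exists_span_singleton_eq_mul (C : ClassGroup (𝓞 F)) (𝔟 : (Ideal (𝓞 F))⁰)
    (hC : ClassGroup.mk0 𝔟 = C⁻¹) (I : {I : (Ideal (𝓞 F))⁰ // ClassGroup.mk0 I = C}) :
    ∃ z : (𝔟 : Ideal (𝓞 F)), z ≠ 0 ∧
      Ideal.span {(z : 𝓞 F)} = (I : Ideal (𝓞 F)) * (𝔟 : Ideal (𝓞 F)) := by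
  have h0 : (I : Ideal (𝓞 F)) * (𝔟 : Ideal (𝓞 F)) ≠ ⊥ :=
    mul_ne_zero (nonZeroDivisors.coe_ne_zero I.1) (nonZeroDivisors.coe_ne_zero 𝔟)
  have h1 : ClassGroup.mk0 (⟨(I : Ideal (𝓞 F)) * (𝔟 : Ideal (𝓞 F)),
      mem_nonZeroDivisors_of_ne_zero h0⟩ : (Ideal (𝓞 F))⁰) = 1 := by
    have h2 : ClassGroup.mk0 I.1 * ClassGroup.mk0 𝔟 = 1 := by rw [I.2, hC, mul_inv_cancel]
    rwa [← map_mul] at h2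
  rw [ClassGroup.mk0_eq_one_iff] at h1
  have hz := Ideal.span_singleton_generator ((I : Ideal (𝓞 F)) * (𝔟 : Ideal (𝓞 F)))
  set z := Submodule.IsPrincipal.generator ((I : Ideal (𝓞 F)) * (𝔟 : Ideal (𝓞 F)))
  have hzb : z ∈ (𝔟 : Ideal (𝓞 F)) := by
    have h2 := Ideal.mem_span_singleton_self z
    rw [hz] at h2
    have h3 : (I : Ideal (𝓞 F)) * (𝔟 : Ideal (𝓞 F)) ≤ (𝔟 : Ideal (𝓞 F)) := Ideal.mul_le_right
    exact h3 h2
  refine ⟨⟨z, hzb⟩, fun hz0 => ?_, hz⟩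
  have hz0 : z = 0 := congrArg Subtype.val hz0
  rw [hz0, Ideal.span_singleton_zero] at hz
  exact h0 hz.symm

lemma exists_mul_eq_span_singleton (C : ClassGroup (𝓞 F)) (𝔟 : (Ideal (𝓞 F))⁰)
    (hC : ClassGroup.mk0 𝔟 = C⁻¹) {z : (𝔟 : Ideal (𝓞 F))} (hz : z ≠ 0) :
    ∃ I : {I : (Ideal (𝓞 F))⁰ // ClassGroup.mk0 I = C},
      Ideal.span {(z : 𝓞 F)} = (I : Ideal (𝓞 F)) * (𝔟 : Ideal (𝓞 F)) := by
  obtain ⟨I, hI⟩ := Ideal.dvd_iff_le.mpr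
    ((Ideal.span_singleton_le_iff_mem (𝔟 : Ideal (𝓞 F))).mpr z.2)
  have hz0 : Ideal.span {(z : 𝓞 F)} ≠ ⊥ := by simpa using hz
  have hI0 : I ≠ ⊥ := by
    rintro rfl
    exact hz0 (by simpa using hI)
  refine ⟨⟨⟨I, mem_nonZeroDivisors_of_ne_zero hI0⟩, ?_⟩, by rw [hI, mul_comm]⟩
  have h1 : ClassGroup.mk0 (𝔟 * ⟨I, mem_nonZeroDivisors_of_ne_zero hI0⟩) = 1 := by
    rw [ClassGroup.mk0_eq_one_iff (𝔟 * ⟨I, mem_nonZeroDivisors_of_ne_zero hI0⟩).2]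
    exact ⟨(z : 𝓞 F), hI.symm⟩
  rw [map_mul, hC, inv_mul_eq_one] at h1
  exact h1.symm

omit [NumberField F] in
lemma signPair_zpow_smul (hη : 0 < σ₁ (η : 𝓞 F)) (hη0 : 0 < σ₂ (η : 𝓞 F)) (j : ℤ) (z : 𝔟) :
    signPair σ₁ σ₂ (η ^ j • z) = signPair σ₁ σ₂ z := by
  simp only [signPair, map_unit_smul, map_unit_zpow, sign_mul, sign_pos (zpow_pos hη j),
    sign_pos (zpow_pos hη0 j), one_mul]

lemma exists_equiv_sigma_unitCone (h : IsRealPair σ₁ σ₂) (C : ClassGroup (𝓞 F))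
    (𝔟 : (Ideal (𝓞 F))⁰) (hC : ClassGroup.mk0 𝔟 = C⁻¹) (hη0 : 0 < σ₂ (η : 𝓞 F))
    (hη : σ₂ (η : 𝓞 F) < σ₁ (η : 𝓞 F)) (hk : 0 < k) :
    ∃ (E : Type) (_ : Finite E) (_ : Nonempty E) (Θ : E → (𝔟 : Ideal (𝓞 F))),
      (∀ e, (Θ e : 𝓞 F) ≠ 0) ∧
      ∃ f : (Σ e, unitCone σ₁ σ₂ η 𝔟 k (Θ e)) ≃ {I : (Ideal (𝓞 F))⁰ // ClassGroup.mk0 I = C} ×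
          ((𝓞 F)ˣ ⧸ Subgroup.zpowers η),
        ∀ x, relAbsNorm (𝔟 : Ideal (𝓞 F)) (x.2 : (𝔟 : Ideal (𝓞 F))) =
          Ideal.absNorm ((f x).1 : Ideal (𝓞 F)) := by
  have h𝔟 : (𝔟 : Ideal (𝓞 F)) ≠ ⊥ := nonZeroDivisors.coe_ne_zero 𝔟
  have hη1 : 0 < σ₁ (η : 𝓞 F) := hη0.trans hη
  let E := {e : SignType × SignType // ∃ z : (𝔟 : Ideal (𝓞 F)), z ≠ 0 ∧ signPair σ₁ σ₂ z = e}
  choose Θ hΘ0 hΘ using fun e : E => e.2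
  have hΘ0' (e : E) : (Θ e : 𝓞 F) ≠ 0 := by simpa using hΘ0 e
  have hx0 (x : Σ e, unitCone σ₁ σ₂ η 𝔟 k (Θ e)) :
      (x.2 : (𝔟 : Ideal (𝓞 F))) ≠ 0 ∧ signPair σ₁ σ₂ (x.2 : (𝔟 : Ideal (𝓞 F))) = x.1 := by
    have h1 := relAbsNorm_eq_coneForm h h𝔟 hη hη0 hk (hΘ0' x.1) x.2.2
    have h2 : (x.2 : (𝔟 : Ideal (𝓞 F))) ≠ 0 := by
      intro h0
      have h3 := h1.2.2.1
      rw [h0] at h3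
      simp at h3
    exact ⟨h2, by rw [← hΘ x.1, signPair_eq_iff h2 (hΘ0 _)]; exact h1.2.2⟩
  have hex (z : (𝔟 : Ideal (𝓞 F))) (hz : z ≠ 0) :
      ∃ (x : Σ e, unitCone σ₁ σ₂ η 𝔟 k (Θ e)) (j : ℤ),
        (x.2 : (𝔟 : Ideal (𝓞 F))) = η ^ j • z := by
    let e : E := ⟨signPair σ₁ σ₂ z, z, hz, rfl⟩
    obtain ⟨h1, h2⟩ := (signPair_eq_iff hz (hΘ0 e)).mp (hΘ e).symm
    obtain ⟨j, hj⟩ := exists_zpow_smul_mem_unitCone hη hη0 hk h1 h2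
    exact ⟨⟨e, _, hj⟩, j, rfl⟩
  have huniq (x y : Σ e, unitCone σ₁ σ₂ η 𝔟 k (Θ e)) (j : ℤ)
      (hxy : (x.2 : (𝔟 : Ideal (𝓞 F))) = η ^ j • (y.2 : (𝔟 : Ideal (𝓞 F)))) : x = y := by
    obtain ⟨e, x, hx⟩ := x
    obtain ⟨e', y, hy⟩ := y
    have he : e = e' := by
      have h1 := (hx0 ⟨e, x, hx⟩).2
      rw [hxy, signPair_zpow_smul hη1 hη0] at h1
      exact Subtype.ext (h1.symm.trans (hx0 ⟨e', y, hy⟩).2)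
    subst he
    dsimp only at hxy
    obtain ⟨h1, h2⟩ := (relAbsNorm_eq_coneForm h h𝔟 hη hη0 hk (hΘ0' e) hy).2.2
    have hj := eq_zero_of_zpow_smul_mem_unitCone hη hη0 hk h1 h2 hy (hxy ▸ hx)
    subst hj
    rw [zpow_zero, one_smul] at hxy
    subst hxy
    rfl
  choose zI hzI0 hzI using exists_span_singleton_eq_mul C 𝔟 hC
  have hdec (x : Σ e, unitCone σ₁ σ₂ η 𝔟 k (Θ e)) :
      ∃ (I : {I : (Ideal (𝓞 F))⁰ // ClassGroup.mk0 I = C}) (u : (𝓞 F)ˣ),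
        (x.2 : (𝔟 : Ideal (𝓞 F))) = u • zI I := by
    obtain ⟨I, hI⟩ := exists_mul_eq_span_singleton C 𝔟 hC (hx0 x).1
    obtain ⟨u, hu⟩ := Ideal.span_singleton_eq_span_singleton.mp (hI.trans (hzI I).symm)
    refine ⟨I, u⁻¹, ?_⟩
    rw [eq_inv_smul_iff]
    ext1
    simp [Units.smul_def, ← hu, mul_comm]
  choose fI fu hf using hdec
  have hspan (I : {I : (Ideal (𝓞 F))⁰ // ClassGroup.mk0 I = C}) (u : (𝓞 F)ˣ) :
      Ideal.span {((u • zI I : (𝔟 : Ideal (𝓞 F))) : 𝓞 F)} =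
        (I : Ideal (𝓞 F)) * (𝔟 : Ideal (𝓞 F)) := by
    rw [← hzI I, Ideal.span_singleton_eq_span_singleton]
    refine ⟨u⁻¹, ?_⟩
    simp only [Units.smul_def, Submodule.coe_smul, smul_eq_mul]
    rw [mul_right_comm, Units.mul_inv, one_mul]
  have hbij : Function.Bijective (fun x => (fI x, (fu x : (𝓞 F)ˣ ⧸ Subgroup.zpowers η))) := by
    refine ⟨fun x y hxy => ?_, fun ⟨I, c⟩ => ?_⟩
    · simp only [Prod.mk.injEq] at hxy
      obtain ⟨j, hj⟩ := Subgroup.mem_zpowers_iff.mp (QuotientGroup.eq.mp hxy.2)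
      refine (huniq y x j ?_).symm
      rw [hf y, hf x, ← hxy.1, smul_smul, hj, mul_comm, mul_inv_cancel_left]
    · obtain ⟨u, rfl⟩ := QuotientGroup.mk_surjective c
      obtain ⟨x, j, hxj⟩ := hex (u • zI I) fun h0 => hzI0 I (by
        rwa [smul_eq_zero_iff_eq] at h0)
      refine ⟨x, ?_⟩
      have hI : fI x = I := by
        have h1 := hspan (fI x) (fu x)
        rw [← hf x, hxj, smul_smul, hspan] at h1
        exact Subtype.ext (Subtype.ext (mul_right_cancel₀ h𝔟 h1)).symm
      refine Prod.ext hI (QuotientGroup.eq.mpr (Subgroup.mem_zpowers_iff.mpr ⟨-j, ?_⟩))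
      have h2 : fu x • zI I = (η ^ j * u) • zI I := by
        rw [← smul_smul, ← hxj, hf x, hI]
      have h3 : fu x = η ^ j * u := by
        ext1
        have h4 := congrArg Subtype.val h2
        simp only [Units.smul_def, Submodule.coe_smul, smul_eq_mul] at h4
        exact mul_right_cancel₀ (by simpa using hzI0 I) h4
      rw [h3]
      simp [zpow_neg]
  refine ⟨E, inferInstance, ?_, Θ, hΘ0', Equiv.ofBijective _ hbij, fun x => ?_⟩
  · obtain ⟨z, hz, hz0⟩ := (Submodule.ne_bot_iff _).mp h𝔟
    exact ⟨⟨signPair σ₁ σ₂ ⟨z, hz⟩, ⟨z, hz⟩, by simpa using hz0, rfl⟩⟩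
  · refine relAbsNorm_eq_absNorm h𝔟 ?_
    rw [hf x]
    exact hspan _ _

lemma exists_norm_tsum_class_le (h : IsRealPair σ₁ σ₂) {n : ℕ} [NeZero n]
    (ψ : DirichletCharacter ℂ n) (a : (ZMod n)ˣ) (ha : ψ a ^ 2 ≠ 1) (C : ClassGroup (𝓞 F)) :
    ∃ B : ℝ, ∀ s : ℝ, 1 < s → s < 2 →
      ‖∑' I : {I : (Ideal (𝓞 F))⁰ // ClassGroup.mk0 I = C},
        ψ (Ideal.absNorm (I : Ideal (𝓞 F)) : ZMod n) *
          (((Ideal.absNorm (I : Ideal (𝓞 F)) : ℝ) ^ (-s) : ℝ) : ℂ)‖ ≤ B := by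
  obtain ⟨𝔟, h𝔟C⟩ := ClassGroup.mk0_surjective C⁻¹
  have h𝔟 : (𝔟 : Ideal (𝓞 F)) ≠ ⊥ := nonZeroDivisors.coe_ne_zero 𝔟
  obtain ⟨η, hη0, hη, -⟩ := h.exists_unit
  obtain ⟨k, hkn⟩ : ∃ k, k = n * Ideal.absNorm (𝔟 : Ideal (𝓞 F)) := ⟨_, rfl⟩
  have hk : 0 < k := hkn ▸ Nat.mul_pos (NeZero.pos n)
    (Nat.pos_of_ne_zero fun h => h𝔟 (Ideal.absNorm_eq_zero_iff.mp h))
  obtain ⟨E, hE, hE0, Θ, hΘ, f, hf⟩ := exists_equiv_sigma_unitCone h C 𝔟 h𝔟C hη0 hη hk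
  have := Fintype.ofFinite E
  choose hsum B hB using fun e => exists_norm_tsum_quadrant_le h h𝔟 hη0 hη (hΘ e) ψ hkn a ha
  have hS (s : ℝ) (hs : 1 < s) : Summable fun x : Σ e, unitCone σ₁ σ₂ η 𝔟 k (Θ e) =>
      (relAbsNorm (𝔟 : Ideal (𝓞 F)) (x.2 : (𝔟 : Ideal (𝓞 F))) : ℝ) ^ (-s) :=
    (summable_sigma_of_nonneg fun x => by positivity).mpr
      ⟨fun e => hsum e s hs, Summable.of_finite⟩
  obtain ⟨I₀, hI₀⟩ := ClassGroup.mk0_surjective C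
  have hfin : Finite ((𝓞 F)ˣ ⧸ Subgroup.zpowers η) := by
    have h1 := (f.symm.summable_iff.mpr (hS 2 one_lt_two)).comp_injective
      (Prod.mk_right_injective ⟨I₀, hI₀⟩)
    simp only [Function.comp_def, hf, Equiv.apply_symm_apply] at h1
    refine Finite.of_summable_const ?_ h1
    have := absNorm_pos_of_mem I₀
    positivity
  have := Fintype.ofFinite ((𝓞 F)ˣ ⧸ Subgroup.zpowers η)
  refine ⟨∑ e, B e, fun s hs hs2 => ?_⟩
  set g : ℕ → ℂ := fun N => ψ (N : ZMod n) * (((N : ℝ) ^ (-s) : ℝ) : ℂ) with hg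
  have hgle (N : ℕ) : ‖g N‖ ≤ (N : ℝ) ^ (-s) := by
    rw [hg, norm_mul, Complex.norm_of_nonneg (by positivity)]
    exact mul_le_of_le_one_left (by positivity) (ψ.norm_le_one _)
  have hgS : Summable fun x : Σ e, unitCone σ₁ σ₂ η 𝔟 k (Θ e) =>
      g (relAbsNorm (𝔟 : Ideal (𝓞 F)) (x.2 : (𝔟 : Ideal (𝓞 F)))) :=
    Summable.of_norm_bounded (hS s hs) fun x => hgle _
  have h1 : ∑' x : Σ e, unitCone σ₁ σ₂ η 𝔟 k (Θ e),
      g (relAbsNorm (𝔟 : Ideal (𝓞 F)) (x.2 : (𝔟 : Ideal (𝓞 F)))) =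
      ∑ e, ∑' z : unitCone σ₁ σ₂ η 𝔟 k (Θ e),
        g (relAbsNorm (𝔟 : Ideal (𝓞 F)) (z : (𝔟 : Ideal (𝓞 F)))) := by
    rw [hgS.tsum_sigma, tsum_fintype]
  have h2 : ∑' x : Σ e, unitCone σ₁ σ₂ η 𝔟 k (Θ e),
      g (relAbsNorm (𝔟 : Ideal (𝓞 F)) (x.2 : (𝔟 : Ideal (𝓞 F)))) =
      (Fintype.card ((𝓞 F)ˣ ⧸ Subgroup.zpowers η) : ℂ) *
        ∑' I : {I : (Ideal (𝓞 F))⁰ // ClassGroup.mk0 I = C},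
          g (Ideal.absNorm (I : Ideal (𝓞 F))) := by
    simp_rw [hf]
    have hS' : Summable fun p : {I : (Ideal (𝓞 F))⁰ // ClassGroup.mk0 I = C} ×
        ((𝓞 F)ˣ ⧸ Subgroup.zpowers η) => g (Ideal.absNorm (p.1 : Ideal (𝓞 F))) := by
      rw [← f.summable_iff]
      simpa only [Function.comp_def, hf] using hgS
    rw [f.tsum_eq (fun p => g (Ideal.absNorm (p.1 : Ideal (𝓞 F)))), hS'.tsum_prod]
    simp only [tsum_fintype, Finset.sum_const, Finset.card_univ, nsmul_eq_mul]
    rw [tsum_mul_left]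
  have hw : (1 : ℝ) ≤ Fintype.card ((𝓞 F)ˣ ⧸ Subgroup.zpowers η) := by
    exact_mod_cast Fintype.card_pos
  have h3 : ‖∑ e, ∑' z : unitCone σ₁ σ₂ η 𝔟 k (Θ e),
      g (relAbsNorm (𝔟 : Ideal (𝓞 F)) (z : (𝔟 : Ideal (𝓞 F))))‖ ≤ ∑ e, B e :=
    (norm_sum_le _ _).trans (Finset.sum_le_sum fun e _ => hB e s hs hs2)
  rw [← h1, h2, norm_mul, Complex.norm_natCast] at h3
  exact (le_mul_of_one_le_left (norm_nonneg _) hw).trans h3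

end RealQuadratic

section ExtendZero

variable {M : Type*} [CommMonoidWithZero M] [NoZeroDivisors M] [Nontrivial M]

open scoped Classical in
/-- Extension by zero of a multiplicative function on the nonzero elements. -/
def extendZero (g : M⁰ →* ℂ) : M →*₀ ℂ where
  toFun x := if h : x ∈ M⁰ then g ⟨x, h⟩ else 0
  map_zero' := dif_neg zero_notMem_nonZeroDivisors
  map_one' := (dif_pos (one_mem _)).trans (map_one g)
  map_mul' x y := by
    by_cases hx : x ∈ M⁰
    · by_cases hy : y ∈ M⁰
      · rw [dif_pos (mul_mem hx hy), dif_pos hx, dif_pos hy, ← map_mul]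
        rfl
      · rw [dif_neg hy, dif_neg (fun h => hy (mul_mem_nonZeroDivisors.mp h).2), mul_zero]
    · rw [dif_neg hx, dif_neg (fun h => hx (mul_mem_nonZeroDivisors.mp h).1), zero_mul]

omit [NoZeroDivisors M] in
lemma extendZero_coe (g : M⁰ →* ℂ) (x : M⁰) : extendZero g (x : M) = g x := by
  classical
  exact dif_pos x.2

end ExtendZero

section LFunction

lemma tsum_eq_sum_tsum_fiber {α κ : Type*} [Fintype κ] {f : α → ℂ} (hf : Summable f)
    (c : α → κ) : ∑' a, f a = ∑ C, ∑' a : {a // c a = C}, f a := by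
  have h2 : Summable fun x => f (Equiv.sigmaFiberEquiv c x) :=
    (Equiv.sigmaFiberEquiv c).summable_iff.mpr hf
  rw [← (Equiv.sigmaFiberEquiv c).tsum_eq, h2.tsum_sigma, tsum_fintype]
  rfl

variable {K : Type*} [Field K] [NumberField K]

/-- The completely multiplicative function `I ↦ χ([I]) φ(N I) N I ^ (-s)` on ideals. -/
def idealChar (χ : ClassGroup (𝓞 K) →* ℂ) (φ : ℕ →* ℂ) (s : ℝ) : Ideal (𝓞 K) →*₀ ℂ :=
  extendZero
    { toFun := fun I => χ (ClassGroup.mk0 I) * φ (Ideal.absNorm (I : Ideal (𝓞 K))) *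
        (((Ideal.absNorm (I : Ideal (𝓞 K)) : ℝ) ^ (-s) : ℝ) : ℂ)
      map_one' := by simp
      map_mul' := fun I J => by
        rw [map_mul, map_mul, Submonoid.coe_mul, map_mul, map_mul,
          Nat.cast_mul, Real.mul_rpow (Nat.cast_nonneg _) (Nat.cast_nonneg _)]
        push_cast
        ring }

variable (χ : ClassGroup (𝓞 K) →* ℂ) (φ : ℕ →* ℂ) (s : ℝ)

lemma idealChar_coe (I : (Ideal (𝓞 K))⁰) : idealChar χ φ s (I : Ideal (𝓞 K)) =
    χ (ClassGroup.mk0 I) * φ (Ideal.absNorm (I : Ideal (𝓞 K))) *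
      (((Ideal.absNorm (I : Ideal (𝓞 K)) : ℝ) ^ (-s) : ℝ) : ℂ) :=
  extendZero_coe _ I

lemma norm_classChar_apply (C : ClassGroup (𝓞 K)) : ‖χ C‖ = 1 := by
  refine Complex.norm_eq_one_of_pow_eq_one (n := Nat.card (ClassGroup (𝓞 K))) ?_ Nat.card_pos.ne'
  rw [← map_pow, pow_card_eq_one', map_one]

lemma norm_idealChar_le (hφ : ∀ N, ‖φ N‖ ≤ 1) (I : (Ideal (𝓞 K))⁰) :
    ‖idealChar χ φ s (I : Ideal (𝓞 K))‖ ≤ (Ideal.absNorm (I : Ideal (𝓞 K)) : ℝ) ^ (-s) := by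
  rw [idealChar_coe, norm_mul, norm_mul, norm_classChar_apply, one_mul,
    Complex.norm_of_nonneg (by positivity)]
  exact mul_le_of_le_one_left (by positivity) (hφ _)

lemma support_idealChar_subset :
    Function.support (idealChar χ φ s) ⊆ ((Ideal (𝓞 K))⁰ : Set (Ideal (𝓞 K))) := by
  intro I hI
  refine mem_nonZeroDivisors_of_ne_zero ?_
  rintro rfl
  exact hI (map_zero _)

variable {s} in
lemma summable_idealChar_coe (hφ : ∀ N, ‖φ N‖ ≤ 1) (hs : 1 < s) :
    Summable fun I : (Ideal (𝓞 K))⁰ => idealChar χ φ s (I : Ideal (𝓞 K)) :=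
  Summable.of_norm_bounded (summable_absNorm_rpow hs) (norm_idealChar_le χ φ s hφ)

variable {s} in
lemma summable_idealChar (hφ : ∀ N, ‖φ N‖ ≤ 1) (hs : 1 < s) : Summable (idealChar χ φ s) := by
  have h := (hasSum_subtype_iff_of_support_subset (support_idealChar_subset χ φ s)).mp
    (summable_idealChar_coe χ φ hφ hs).hasSum
  exact h.summable

lemma tsum_idealChar_eq : ∑' I, idealChar χ φ s I =
    ∑' I : (Ideal (𝓞 K))⁰, idealChar χ φ s (I : Ideal (𝓞 K)) :=
  (tsum_subtype_eq_of_support_subset (support_idealChar_subset χ φ s)).symm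

variable {s} in
lemma tsum_idealChar_eq_sum_class (hφ : ∀ N, ‖φ N‖ ≤ 1) (hs : 1 < s) :
    ∑' I, idealChar χ φ s I = ∑ C : ClassGroup (𝓞 K), χ C *
      ∑' I : {I : (Ideal (𝓞 K))⁰ // ClassGroup.mk0 I = C},
        φ (Ideal.absNorm (I : Ideal (𝓞 K))) *
          (((Ideal.absNorm (I : Ideal (𝓞 K)) : ℝ) ^ (-s) : ℝ) : ℂ) := by
  rw [tsum_idealChar_eq, tsum_eq_sum_tsum_fiber (summable_idealChar_coe χ φ hφ hs)
    (ClassGroup.mk0 (R := 𝓞 K))]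
  refine Finset.sum_congr rfl fun C _ => ?_
  rw [← tsum_mul_left]
  refine tsum_congr fun I => ?_
  rw [← mul_assoc, idealChar_coe, I.2]

/-- The nonzero ideal underlying a prime. -/
def primeIdeal (P : HeightOneSpectrum (𝓞 K)) : (Ideal (𝓞 K))⁰ :=
  ⟨P.asIdeal, mem_nonZeroDivisors_of_ne_zero P.ne_bot⟩

omit [NumberField K] in
lemma primeIdeal_injective : Function.Injective (primeIdeal (K := K)) := fun _ _ h =>
  HeightOneSpectrum.ext (congrArg Subtype.val h)

lemma two_le_absNorm (P : HeightOneSpectrum (𝓞 K)) : 2 ≤ Ideal.absNorm P.asIdeal := by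
  have h1 := absNorm_pos_of_mem (primeIdeal P)
  have h2 : Ideal.absNorm P.asIdeal ≠ 1 := fun h =>
    P.isPrime.ne_top (Ideal.absNorm_eq_one_iff.mp h)
  change 0 < Ideal.absNorm P.asIdeal at h1
  omega

variable {s} in
lemma summable_prime_rpow (hs : 1 < s) :
    Summable fun P : HeightOneSpectrum (𝓞 K) => (Ideal.absNorm P.asIdeal : ℝ) ^ (-s) := by
  have h := (summable_absNorm_rpow (K := K) hs).comp_injective (primeIdeal_injective (K := K))
  refine h.congr fun P => ?_
  rw [Function.comp_apply, primeIdeal]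

variable {s} in
lemma absNorm_rpow_le_half (hs : 1 < s) (P : HeightOneSpectrum (𝓞 K)) :
    (Ideal.absNorm P.asIdeal : ℝ) ^ (-s) ≤ 1 / 2 := by
  have h2 : (2 : ℝ) ≤ Ideal.absNorm P.asIdeal := by exact_mod_cast two_le_absNorm P
  calc (Ideal.absNorm P.asIdeal : ℝ) ^ (-s) ≤ (Ideal.absNorm P.asIdeal : ℝ) ^ (-1 : ℝ) :=
        Real.rpow_le_rpow_of_exponent_le (by linarith) (by linarith)
    _ ≤ 1 / 2 := by
        rw [Real.rpow_neg_one, one_div]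
        exact inv_anti₀ two_pos h2

variable {s} in
lemma absNorm_rpow_sq_le (hs : 1 < s) (P : HeightOneSpectrum (𝓞 K)) :
    ((Ideal.absNorm P.asIdeal : ℝ) ^ (-s)) ^ 2 ≤ (Ideal.absNorm P.asIdeal : ℝ) ^ (-2 : ℝ) := by
  have h2 : (2 : ℝ) ≤ Ideal.absNorm P.asIdeal := by exact_mod_cast two_le_absNorm P
  rw [← Real.rpow_natCast, ← Real.rpow_mul (by linarith)]
  exact Real.rpow_le_rpow_of_exponent_le (by linarith) (by push_cast; linarith)

variable (K) in
/-- The constant `∑ N P ^ (-2)`. -/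
def primeSumTwo : ℝ := ∑' P : HeightOneSpectrum (𝓞 K), (Ideal.absNorm P.asIdeal : ℝ) ^ (-2 : ℝ)

variable {s} in
lemma exp_re_le_norm_tsum_idealChar (hφ : ∀ N, ‖φ N‖ ≤ 1) (hs : 1 < s) :
    (Summable fun P : HeightOneSpectrum (𝓞 K) => (idealChar χ φ s P.asIdeal).re) ∧
    Real.exp (∑' P : HeightOneSpectrum (𝓞 K), (idealChar χ φ s P.asIdeal).re -
      primeSumTwo K / 2) ≤ ‖∑' I, idealChar χ φ s I‖ := by
  have hb (P : HeightOneSpectrum (𝓞 K)) : ‖idealChar χ φ s P.asIdeal‖ ≤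
      (Ideal.absNorm P.asIdeal : ℝ) ^ (-s) := norm_idealChar_le χ φ s hφ (primeIdeal P)
  have hb2 (P : HeightOneSpectrum (𝓞 K)) : ‖idealChar χ φ s P.asIdeal‖ ^ 2 ≤
      (Ideal.absNorm P.asIdeal : ℝ) ^ (-2 : ℝ) :=
    (pow_le_pow_left₀ (norm_nonneg _) (hb P) 2).trans (absNorm_rpow_sq_le hs P)
  have hS := Summable.of_norm_bounded (summable_prime_rpow hs) hb
  have hS2 := Summable.of_nonneg_of_le (fun P => by positivity) hb2
    (summable_prime_rpow one_lt_two)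
  refine ⟨Complex.reCLM.summable hS, le_trans (Real.exp_le_exp.mpr ?_)
    (exp_le_norm_tsum _ (summable_idealChar χ φ hφ hs) (fun P h => ?_) hS hS2)⟩
  · have := hS2.tsum_le_tsum hb2 (summable_prime_rpow one_lt_two)
    rw [primeSumTwo]
    linarith
  · have h1 := (hb P).trans (absNorm_rpow_le_half hs P)
    rw [h, norm_one] at h1
    norm_num at h1

variable {s} in
lemma tsum_absNorm_rpow_le_exp (hs : 1 < s) :
    ∑' I : (Ideal (𝓞 K))⁰, (Ideal.absNorm (I : Ideal (𝓞 K)) : ℝ) ^ (-s) ≤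
      Real.exp (∑' P : HeightOneSpectrum (𝓞 K), (Ideal.absNorm P.asIdeal : ℝ) ^ (-s) +
        2 * primeSumTwo K) := by
  have h1 (I : (Ideal (𝓞 K))⁰) : idealChar 1 1 s (I : Ideal (𝓞 K)) =
      (((Ideal.absNorm (I : Ideal (𝓞 K)) : ℝ) ^ (-s) : ℝ) : ℂ) := by
    rw [idealChar_coe]
    simp
  have hb (P : HeightOneSpectrum (𝓞 K)) : ‖idealChar (K := K) 1 1 s P.asIdeal‖ =
      (Ideal.absNorm P.asIdeal : ℝ) ^ (-s) := by
    refine (congrArg norm (h1 (primeIdeal P))).trans (Complex.norm_of_nonneg ?_)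
    positivity
  have hb2 (P : HeightOneSpectrum (𝓞 K)) : ‖idealChar (K := K) 1 1 s P.asIdeal‖ ^ 2 ≤
      (Ideal.absNorm P.asIdeal : ℝ) ^ (-2 : ℝ) := by
    rw [hb]
    exact absNorm_rpow_sq_le hs P
  have hS2 := Summable.of_nonneg_of_le (fun P => by positivity) hb2
    (summable_prime_rpow one_lt_two)
  have h2 := norm_tsum_le_exp (idealChar (K := K) 1 1 s)
    (summable_idealChar 1 1 (by simp) hs) (fun P => (hb P).trans_le (absNorm_rpow_le_half hs P))
    (by simpa only [hb] using summable_prime_rpow hs) hS2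
  simp only [tsum_idealChar_eq, h1, ← Complex.ofReal_tsum] at h2
  rw [Complex.norm_of_nonneg (tsum_nonneg fun I => by positivity)] at h2
  refine h2.trans (Real.exp_le_exp.mpr ?_)
  have := hS2.tsum_le_tsum hb2 (summable_prime_rpow one_lt_two)
  simp only [hb] at this ⊢
  rw [primeSumTwo]
  linarith

end LFunction

section Splitting

variable {K L : Type*} [Field K] [NumberField K] [Field L] [NumberField L] [Algebra K L]

lemma absNorm_eq_pow_inertiaDeg (𝔏 : HeightOneSpectrum (𝓞 L)) (P : HeightOneSpectrum (𝓞 K))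
    [𝔏.asIdeal.LiesOver P.asIdeal] :
    Ideal.absNorm 𝔏.asIdeal = Ideal.absNorm P.asIdeal ^ 𝔏.asIdeal.inertiaDeg (𝓞 K) := by
  have := 𝔏.isMaximal
  have := P.isMaximal
  rw [← Ideal.absNorm_relNorm (𝓞 K), Ideal.relNorm_eq_pow_of_isMaximal 𝔏.asIdeal P.asIdeal, map_pow]

variable (K) in
/-- The prime of `K` below a prime of `L`. -/
def primeBelow (𝔏 : HeightOneSpectrum (𝓞 L)) : HeightOneSpectrum (𝓞 K) where
  asIdeal := 𝔏.asIdeal.under (𝓞 K)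
  isPrime := inferInstance
  ne_bot := mt Ideal.eq_bot_of_comap_eq_bot 𝔏.ne_bot

instance (𝔏 : HeightOneSpectrum (𝓞 L)) : 𝔏.asIdeal.LiesOver (primeBelow K 𝔏).asIdeal :=
  Ideal.over_under _

variable (L) in
omit [NumberField L] in
lemma exists_primeBelow_eq (P : HeightOneSpectrum (𝓞 K)) :
    ∃ 𝔏 : HeightOneSpectrum (𝓞 L), primeBelow K 𝔏 = P := by
  have := P.isMaximal
  obtain ⟨𝔏, h1, h2⟩ := Ideal.exists_maximal_ideal_liesOver_of_isIntegral P.asIdeal (S := 𝓞 L)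
  refine ⟨⟨𝔏, h1.isPrime, ?_⟩, HeightOneSpectrum.ext h2.over.symm⟩
  rintro rfl
  exact P.ne_bot (h2.over.trans (Ideal.comap_bot_of_injective _
    (FaithfulSMul.algebraMap_injective (𝓞 K) (𝓞 L))))

lemma inertiaDeg_dvd_finrank [IsGalois K L] (𝔏 : HeightOneSpectrum (𝓞 L)) :
    𝔏.asIdeal.inertiaDeg (𝓞 K) ∣ finrank K L := by
  have := 𝔏.isPrime
  have := (primeBelow K 𝔏).isPrime
  rw [← IsGalois.card_aut_eq_finrank, ← Ideal.ncard_primesOver_mul_ramificationIdxIn_mul_inertiaDegIn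
    (primeBelow K 𝔏).asIdeal (𝓞 L) Gal(L/K),
    Ideal.inertiaDegIn_eq_inertiaDeg (primeBelow K 𝔏).asIdeal 𝔏.asIdeal Gal(L/K)]
  exact Dvd.intro_left _ (mul_assoc _ _ _)

lemma ncard_primeBelow_fiber_le (P : HeightOneSpectrum (𝓞 K)) :
    {Q : HeightOneSpectrum (𝓞 L) | primeBelow K Q = P}.Finite ∧
    {Q : HeightOneSpectrum (𝓞 L) | primeBelow K Q = P}.ncard ≤ finrank K L := by
  have hP := P.isPrime
  have hfin : (Ideal.primesOver P.asIdeal (𝓞 L)).Finite :=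
    Algebra.QuasiFinite.finite_primesOver P.asIdeal
  have hmap : ∀ Q ∈ {Q : HeightOneSpectrum (𝓞 L) | primeBelow K Q = P},
      Q.asIdeal ∈ Ideal.primesOver P.asIdeal (𝓞 L) := by
    rintro Q rfl
    exact ⟨Q.isPrime, inferInstance⟩
  have hinj : Set.InjOn (fun Q : HeightOneSpectrum (𝓞 L) => Q.asIdeal)
      {Q : HeightOneSpectrum (𝓞 L) | primeBelow K Q = P} :=
    fun Q _ Q' _ h => HeightOneSpectrum.ext h
  refine ⟨Set.Finite.of_injOn hmap hinj hfin, (Set.ncard_le_ncard_of_injOn _ hmap hinj hfin).trans ?_⟩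
  have := hfin.fintype
  rw [← Set.fintypeCard_eq_ncard,
    IsFractionRing.finrank_eq (𝓞 K) K (𝓞 L) L,
    ← Ideal.sum_ramification_inertia_eq_finrank P.asIdeal (𝓞 L), ← Finset.card_univ,
    Finset.card_eq_sum_ones]
  refine Finset.sum_le_sum fun Q _ => ?_
  have hQ := Q.2.1
  have h1 := Q.1.ramificationIdx_pos (𝓞 K)
  have h2 := Q.1.inertiaDeg_pos (𝓞 K)
  exact Nat.mul_pos h1 h2

variable {n : ℕ} [NeZero n]

lemma exists_prime_absNorm_eq_pow (𝔏 : HeightOneSpectrum (𝓞 L)) : ∃ p : ℕ, p.Prime ∧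
    𝔏.asIdeal.LiesOver (Ideal.span {(p : ℤ)}) ∧
    Ideal.absNorm 𝔏.asIdeal = p ^ 𝔏.asIdeal.inertiaDeg ℤ := by
  have := 𝔏.isMaximal
  have hn0 : NeZero 𝔏.asIdeal := ⟨𝔏.ne_bot⟩
  set p := Ideal.absNorm (𝔏.asIdeal.under ℤ) with hp
  have hp1 : p.Prime := Nat.absNorm_under_prime 𝔏.asIdeal
  have : Fact p.Prime := ⟨hp1⟩
  have hover : 𝔏.asIdeal.LiesOver (Ideal.span {(p : ℤ)}) := by
    rw [hp, Int.ideal_span_absNorm_eq_self]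
    exact Ideal.over_under _
  have hmax : (Ideal.span {(p : ℤ)}).IsMaximal :=
    Int.ideal_span_isMaximal_of_prime p
  refine ⟨p, hp1, hover, ?_⟩
  rw [← Ideal.absNorm_relNorm ℤ, Ideal.relNorm_eq_pow_of_isMaximal 𝔏.asIdeal
    (Ideal.span {(p : ℤ)}), map_pow, Ideal.absNorm_span_singleton]
  simp

lemma exists_absNorm_eq_pow_orderOf [IsCyclotomicExtension {n} ℚ L]
    (𝔏 : HeightOneSpectrum (𝓞 L)) (h : (Ideal.absNorm 𝔏.asIdeal).Coprime n) :
    ∃ p : ℕ, p.Prime ∧ Ideal.absNorm 𝔏.asIdeal = p ^ orderOf (p : ZMod n) := by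
  have := 𝔏.isMaximal
  obtain ⟨p, hp1, hover, h1⟩ := exists_prime_absNorm_eq_pow 𝔏
  have : Fact p.Prime := ⟨hp1⟩
  have hmax : (Ideal.span {(p : ℤ)}).IsMaximal := Int.ideal_span_isMaximal_of_prime p
  refine ⟨p, hp1, ?_⟩
  have hpos : 0 < 𝔏.asIdeal.inertiaDeg ℤ := Ideal.inertiaDeg_pos _ _
  have hpn : ¬ p ∣ n := by
    rw [h1] at h
    exact (hp1.coprime_iff_not_dvd).mp (h.coprime_dvd_left (dvd_pow_self p hpos.ne'))
  rw [h1, IsCyclotomicExtension.Rat.inertiaDeg_eq_of_not_dvd p L 𝔏.asIdeal hpn]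

lemma inertiaDeg_eq_orderOf [IsCyclotomicExtension {n} ℚ L]
    (𝔏 : HeightOneSpectrum (𝓞 L)) (P : HeightOneSpectrum (𝓞 K)) [𝔏.asIdeal.LiesOver P.asIdeal]
    (h : (Ideal.absNorm P.asIdeal).Coprime n) :
    𝔏.asIdeal.inertiaDeg (𝓞 K) = orderOf ((Ideal.absNorm P.asIdeal : ℕ) : ZMod n) := by
  have := 𝔏.isMaximal
  have h1 := absNorm_eq_pow_inertiaDeg 𝔏 P
  obtain ⟨p, hp, hp2⟩ := exists_absNorm_eq_pow_orderOf 𝔏 (n := n) (by rw [h1]; exact h.pow_left _)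
  have hpos : 0 < 𝔏.asIdeal.inertiaDeg (𝓞 K) := Ideal.inertiaDeg_pos _ _
  obtain ⟨a, -, ha⟩ := (Nat.dvd_prime_pow hp).mp (hp2 ▸ h1 ▸ dvd_pow_self _ hpos.ne')
  have h2 : a * 𝔏.asIdeal.inertiaDeg (𝓞 K) = orderOf (p : ZMod n) :=
    Nat.pow_right_injective hp.two_le (by
      change p ^ _ = p ^ _
      rw [← hp2, h1, ha, pow_mul])
  have ha0 : a ≠ 0 := by
    rintro rfl
    have := two_le_absNorm P
    rw [ha, pow_zero] at this
    omega
  rw [ha, Nat.cast_pow, orderOf_pow_of_dvd ha0 ⟨_, h2.symm⟩, ← h2, Nat.mul_div_cancel_left _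
    (Nat.pos_of_ne_zero ha0)]

end Splitting

section Characters

variable (n : ℕ) [NeZero n] (k : ℕ)

/-- The group of Dirichlet characters modulo `n` with `ψ ^ k = 1`. -/
def torsionChars : Subgroup (DirichletCharacter ℂ n) := (powMonoidHom k).ker

instance : Fintype (torsionChars n k) := Fintype.ofFinite _

lemma card_torsionChars :
    Nat.card (torsionChars n k) = Nat.card (powMonoidHom k : (ZMod n)ˣ →* (ZMod n)ˣ).ker := by
  obtain ⟨e⟩ := DirichletCharacter.mulEquiv_units ℂ n
  refine Nat.card_congr (e.toEquiv.subtypeEquiv fun ψ => ?_)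
  change ψ ^ k = 1 ↔ e ψ ^ k = 1
  rw [← map_pow, map_eq_one_iff e e.injective]

variable {n k}

omit [NeZero n] in
lemma torsionChars_apply_eq_one (ψ : torsionChars n k) (u : (ZMod n)ˣ)
    (h : k.Coprime (orderOf (u : ZMod n))) : ψ.1 (u : ZMod n) = 1 := by
  have h1 : ψ.1 (u : ZMod n) ^ k = 1 := by
    have h2 : ψ.1 ^ k = 1 := ψ.2
    rw [← MulChar.pow_apply_coe, h2, MulChar.one_apply_coe]
  have h2 : ψ.1 (u : ZMod n) ^ orderOf (u : ZMod n) = 1 := by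
    rw [← map_pow, pow_orderOf_eq_one, map_one]
  have h3 := Nat.dvd_gcd (orderOf_dvd_of_pow_eq_one h1) (orderOf_dvd_of_pow_eq_one h2)
  rw [Nat.coprime_iff_gcd_eq_one.mp h] at h3
  exact orderOf_eq_one_iff.mp (Nat.dvd_one.mp h3)

lemma exists_torsionChars_apply_ne_one {m : ℕ} (hmk : Nat.card (ZMod n)ˣ = k * m) (u : (ZMod n)ˣ)
    (h : u ^ m ≠ 1) : ∃ ψ : torsionChars n k, ψ.1 (u : ZMod n) ≠ 1 := by
  have h1 : (u : ZMod n) ^ m ≠ 1 := by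
    rwa [← Units.val_pow_eq_pow_val, Ne, Units.val_eq_one]
  obtain ⟨ψ, hψ⟩ := DirichletCharacter.exists_apply_ne_one_of_hasEnoughRootsOfUnity ℂ h1
  refine ⟨⟨ψ ^ m, ?_⟩, ?_⟩
  · change (ψ ^ m) ^ k = 1
    obtain ⟨e⟩ := DirichletCharacter.mulEquiv_units ℂ n
    rw [← pow_mul, mul_comm, ← hmk, ← Nat.card_congr e.toEquiv, pow_card_eq_one']
  · change (ψ ^ m) (u : ZMod n) ≠ 1
    rwa [MulChar.pow_apply_coe, ← map_pow]

omit [NeZero n] in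
lemma sum_torsionChars_eq_zero (u : (ZMod n)ˣ) (h : ∃ ψ : torsionChars n k, ψ.1 (u : ZMod n) ≠ 1) :
    ∑ ψ : torsionChars n k, ψ.1 (u : ZMod n) = 0 := by
  obtain ⟨ψ₀, h0⟩ := h
  have h1 : ψ₀.1 (u : ZMod n) * ∑ ψ : torsionChars n k, ψ.1 (u : ZMod n) =
      ∑ ψ : torsionChars n k, ψ.1 (u : ZMod n) := by
    rw [Finset.mul_sum]
    refine Fintype.sum_bijective _ (Group.mulLeft_bijective ψ₀) _ _ fun ψ => ?_
    rfl
  exact (mul_left_eq_self₀.mp h1).resolve_left h0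

open scoped Classical in
lemma sum_torsionChars_apply {ℓ : ℕ} (hℓ : ℓ.Prime) (u : (ZMod n)ˣ) :
    ∑ ψ : torsionChars n (ℓ ^ (Nat.card (ZMod n)ˣ).factorization ℓ), ψ.1 (u : ZMod n) =
      if ℓ.Coprime (orderOf (u : ZMod n)) then
        (Nat.card (torsionChars n (ℓ ^ (Nat.card (ZMod n)ˣ).factorization ℓ)) : ℂ) else 0 := by
  split_ifs with h
  · rw [Finset.sum_congr rfl fun ψ _ => torsionChars_apply_eq_one ψ u (h.pow_left _)]
    simp [Nat.card_eq_fintype_card]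
  · refine sum_torsionChars_eq_zero u (exists_torsionChars_apply_ne_one
      (Nat.ordProj_mul_ordCompl_eq_self _ ℓ).symm u fun h1 => h ?_)
    rw [orderOf_units]
    exact (Nat.coprime_ordCompl hℓ Nat.card_pos.ne').coprime_dvd_right (orderOf_dvd_of_pow_eq_one h1)

lemma exists_apply_sq_ne_one (hk : Odd k) (ψ : torsionChars n k) (h : ψ ≠ 1) :
    ∃ a : (ZMod n)ˣ, ψ.1 a ^ 2 ≠ 1 := by
  by_contra! h2
  have h3 : ψ ^ 2 = 1 := by
    ext a
    change (ψ.1 ^ 2) (a : ZMod n) = _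
    rw [MulChar.pow_apply_coe, h2, Subgroup.coe_one, MulChar.one_apply_coe]
  have h4 : ψ ^ k = 1 := Subtype.ext ψ.2
  have h5 := Nat.dvd_gcd (orderOf_dvd_of_pow_eq_one h3) (orderOf_dvd_of_pow_eq_one h4)
  rw [Nat.coprime_iff_gcd_eq_one.mp (Nat.coprime_two_left.mpr hk)] at h5
  exact h (orderOf_eq_one_iff.mp (Nat.dvd_one.mp h5))

open scoped Classical in
/-- A Dirichlet character as a multiplicative function on `ℕ`, the trivial one being replaced by
the constant function `1`. -/
def natChar (ψ : DirichletCharacter ℂ n) : ℕ →* ℂ :=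
  if ψ = 1 then 1 else ψ.toMonoidHom.comp (Nat.castRingHom (ZMod n)).toMonoidHom

lemma natChar_one : natChar (1 : DirichletCharacter ℂ n) = 1 := if_pos rfl

lemma natChar_apply {ψ : DirichletCharacter ℂ n} (h : ψ ≠ 1) (N : ℕ) :
    natChar ψ N = ψ (N : ZMod n) := by
  rw [natChar, if_neg h]
  rfl

lemma natChar_apply_unit (ψ : DirichletCharacter ℂ n) {N : ℕ} (h : N.Coprime n) :
    natChar ψ N = ψ (ZMod.unitOfCoprime N h : ZMod n) := by
  rw [ZMod.coe_unitOfCoprime]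
  by_cases h1 : ψ = 1
  · rw [h1, natChar_one, ← ZMod.coe_unitOfCoprime N h, MulChar.one_apply_coe, MonoidHom.one_apply]
  · rw [natChar_apply h1]

lemma norm_natChar_le (ψ : DirichletCharacter ℂ n) (N : ℕ) : ‖natChar ψ N‖ ≤ 1 := by
  by_cases h : ψ = 1
  · rw [h, natChar_one]
    simp
  · rw [natChar_apply h]
    exact DirichletCharacter.norm_le_one _ _

lemma sum_natChar_of_not_coprime {N : ℕ} (h : ¬ N.Coprime n) :
    ∑ ψ : torsionChars n k, natChar ψ.1 N = 1 := by
  rw [Fintype.sum_eq_single (1 : torsionChars n k) fun ψ hψ => ?_]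
  · rw [Subgroup.coe_one, natChar_one, MonoidHom.one_apply]
  · rw [natChar_apply (fun h => hψ (Subtype.ext h))]
    exact MulChar.map_nonunit _ (mt (ZMod.isUnit_iff_coprime N n).mp h)

end Characters

section Comparison

lemma tsum_le_mul_tsum_of_fiber_le {α β : Type*} {π : β → α} {v : β → ℝ} {w : α → ℝ} {d : ℕ}
    (hfin : ∀ a, {b | π b = a}.Finite) (hd : ∀ a, {b | π b = a}.ncard ≤ d) (hw : Summable w)
    (hw0 : ∀ a, 0 ≤ w a) (hvw : ∀ b, v b ≤ w (π b)) : ∑' b, v b ≤ d * ∑' a, w a := by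
  classical
  refine tsum_le_of_sum_le' (mul_nonneg d.cast_nonneg (tsum_nonneg hw0)) fun t => ?_
  calc ∑ b ∈ t, v b ≤ ∑ b ∈ t, w (π b) := Finset.sum_le_sum fun b _ => hvw b
    _ = ∑ a ∈ t.image π, (t.filter fun b => π b = a).card • w a := Finset.sum_comp _ _
    _ ≤ ∑ a ∈ t.image π, d * w a := by
        refine Finset.sum_le_sum fun a _ => ?_
        rw [nsmul_eq_mul]
        refine mul_le_mul_of_nonneg_right (Nat.cast_le.mpr ((le_trans ?_ (hd a)))) (hw0 a)
        rw [← Set.ncard_coe_finset]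
        exact Set.ncard_le_ncard (fun b hb => (Finset.mem_filter.mp hb).2) (hfin a)
    _ ≤ d * ∑' a, w a := by
        rw [← Finset.mul_sum]
        exact mul_le_mul_of_nonneg_left (hw.sum_le_tsum _ fun a _ => hw0 a) d.cast_nonneg

variable {F : Type*} [Field F] [NumberField F] {M : Type*} [Field M] [NumberField M] [Algebra F M]
  {n : ℕ} [NeZero n] {ℓ : ℕ}

variable (n ℓ) in
/-- Primes of residual order prime to `ℓ` in the units modulo `n`. -/
def IsGood (P : HeightOneSpectrum (𝓞 F)) : Prop :=
  (Ideal.absNorm P.asIdeal).Coprime n ∧ ℓ.Coprime (orderOf ((Ideal.absNorm P.asIdeal : ℕ) : ZMod n))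

variable (F n) in
/-- Primes dividing `n`. -/
def badPrimes : Set (HeightOneSpectrum (𝓞 F)) := {P | ¬ (Ideal.absNorm P.asIdeal).Coprime n}

variable (F n) in
lemma finite_badPrimes : (badPrimes F n).Finite := by
  have hn : Ideal.span {(n : 𝓞 F)} ≠ 0 := by
    rw [Ne, Ideal.zero_eq_bot, Ideal.span_singleton_eq_bot]
    exact NeZero.ne _
  refine (Ideal.finite_factors hn).subset fun P hP => ?_
  have := P.isMaximal
  obtain ⟨p, hp, -, hN⟩ := exists_prime_absNorm_eq_pow P
  have h2 : p ∣ n := by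
    by_contra h
    exact hP (hN ▸ (hp.coprime_iff_not_dvd.mpr h).pow_left _)
  have h3 : (p : 𝓞 F) ∈ P.asIdeal := by
    have h4 := Ideal.absNorm_mem P.asIdeal
    rw [hN, Nat.cast_pow] at h4
    exact this.isPrime.mem_of_pow_mem _ h4
  refine Ideal.dvd_span_singleton.mpr ?_
  obtain ⟨c, rfl⟩ := h2
  push_cast
  exact Ideal.mul_mem_right _ _ h3

variable (F n ℓ) in
open scoped Classical in
/-- The sum of `N P ^ (-s)` over the good primes. -/
def goodSum (s : ℝ) : ℝ := ∑' P : HeightOneSpectrum (𝓞 F),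
  if IsGood n ℓ P then (Ideal.absNorm P.asIdeal : ℝ) ^ (-s) else 0

open scoped Classical in
variable (F n ℓ) in
omit [NeZero n] in
lemma summable_good {s : ℝ} (hs : 1 < s) : Summable fun P : HeightOneSpectrum (𝓞 F) =>
    if IsGood n ℓ P then (Ideal.absNorm P.asIdeal : ℝ) ^ (-s) else 0 := by
  refine Summable.of_nonneg_of_le (fun P => ?_) (fun P => ?_) (summable_prime_rpow hs)
  · split_ifs <;> positivity
  · split_ifs
    · exact le_rfl
    · positivity

omit [NeZero n] in
lemma goodSum_nonneg (s : ℝ) : 0 ≤ goodSum F n ℓ s := by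
  classical
  refine tsum_nonneg fun P => ?_
  split_ifs <;> positivity

open scoped Classical in
variable (F n) in
lemma summable_bad : Summable fun P : HeightOneSpectrum (𝓞 F) =>
    if P ∈ badPrimes F n then (1 : ℝ) else 0 :=
  summable_of_hasFiniteSupport ((finite_badPrimes F n).subset fun P hP => by
    by_contra h
    exact hP (if_neg h))

open scoped Classical in
variable (F n) in
/-- The number of primes dividing `n`. -/
def badCount : ℝ := ∑' P : HeightOneSpectrum (𝓞 F), if P ∈ badPrimes F n then (1 : ℝ) else 0

open scoped Classical in
variable (n) in
omit [NeZero n] in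
lemma absNorm_rpow_le_of_primeBelow {s : ℝ} (hs : 1 < s)
    (hgood : ∀ Q : HeightOneSpectrum (𝓞 M), (Ideal.absNorm Q.asIdeal).Coprime n → IsGood n ℓ Q)
    (Q : HeightOneSpectrum (𝓞 M)) : letI P := primeBelow F Q
    (Ideal.absNorm Q.asIdeal : ℝ) ^ (-s) ≤
      (if IsGood n ℓ P then (Ideal.absNorm P.asIdeal : ℝ) ^ (-s) else 0) +
        (Ideal.absNorm P.asIdeal : ℝ) ^ (-2 : ℝ) + if P ∈ badPrimes F n then 1 else 0 := by
  set P := primeBelow F Q with hP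
  have hQ := Q.isMaximal
  have h2 : (2 : ℝ) ≤ Ideal.absNorm P.asIdeal := by exact_mod_cast two_le_absNorm P
  have h0 : (0 : ℝ) ≤ if IsGood n ℓ P then (Ideal.absNorm P.asIdeal : ℝ) ^ (-s) else 0 := by
    split_ifs <;> positivity
  have h0' : (0 : ℝ) ≤ (Ideal.absNorm P.asIdeal : ℝ) ^ (-2 : ℝ) := by positivity
  have h1 : (Ideal.absNorm Q.asIdeal : ℝ) ^ (-s) ≤ 1 / 2 := absNorm_rpow_le_half hs Q
  have hN := absNorm_eq_pow_inertiaDeg Q P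
  have hpos : 0 < Q.asIdeal.inertiaDeg (𝓞 F) := Ideal.inertiaDeg_pos _ _
  by_cases hb : P ∈ badPrimes F n
  · rw [if_pos hb]
    linarith
  rw [if_neg hb]
  have hc : (Ideal.absNorm P.asIdeal).Coprime n := not_not.mp hb
  rcases Nat.lt_or_eq_of_le hpos with h | h
  · have h3 : (Ideal.absNorm Q.asIdeal : ℝ) ^ (-s) ≤ (Ideal.absNorm P.asIdeal : ℝ) ^ (-2 : ℝ) := by
      rw [hN, Nat.cast_pow, ← Real.rpow_natCast, ← Real.rpow_mul (by linarith)]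
      refine Real.rpow_le_rpow_of_exponent_le (by linarith) ?_
      have h4 : (2 : ℝ) ≤ (Q.asIdeal.inertiaDeg (𝓞 F) : ℕ) := by exact_mod_cast h
      nlinarith
    linarith
  · rw [← h, pow_one] at hN
    have h4 : IsGood n ℓ P := by
      have := hgood Q (by rwa [hN])
      rw [IsGood, hN] at this
      exact this
    rw [if_pos h4, hN]
    linarith

lemma tsum_absNorm_rpow_le_exp_goodSum {s : ℝ} (hs : 1 < s)
    (hgood : ∀ Q : HeightOneSpectrum (𝓞 M), (Ideal.absNorm Q.asIdeal).Coprime n → IsGood n ℓ Q) :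
    ∑' I : (Ideal (𝓞 M))⁰, (Ideal.absNorm (I : Ideal (𝓞 M)) : ℝ) ^ (-s) ≤
      Real.exp (finrank F M * (goodSum F n ℓ s + primeSumTwo F + badCount F n) +
        2 * primeSumTwo M) := by
  classical
  refine (tsum_absNorm_rpow_le_exp hs).trans (Real.exp_le_exp.mpr (add_le_add_left ?_ _))
  have h1 := summable_good F n ℓ hs
  have h2 := summable_prime_rpow (K := F) one_lt_two
  have h3 := summable_bad F n
  rw [goodSum, primeSumTwo, badCount, ← h1.tsum_add h2, ← (h1.add h2).tsum_add h3]
  refine tsum_le_mul_tsum_of_fiber_le (fun P => (ncard_primeBelow_fiber_le P).1)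
    (fun P => (ncard_primeBelow_fiber_le P).2) ((h1.add h2).add h3) (fun P => ?_)
    (fun Q => absNorm_rpow_le_of_primeBelow n hs hgood Q)
  refine add_nonneg (add_nonneg ?_ (by positivity)) ?_ <;> split_ifs <;> positivity

open scoped Classical in
lemma le_sum_re_idealChar (hℓ : ℓ.Prime) {χ : ClassGroup (𝓞 F) →* ℂ}
    (hχ : ∀ P : HeightOneSpectrum (𝓞 F), IsGood n ℓ P → χ (ClassGroup.mk0 (primeIdeal P)) = 1)
    {s : ℝ} (hs : 1 < s) (P : HeightOneSpectrum (𝓞 F)) :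
    letI X := torsionChars n (ℓ ^ (Nat.card (ZMod n)ˣ).factorization ℓ)
    Nat.card X * (if IsGood n ℓ P then (Ideal.absNorm P.asIdeal : ℝ) ^ (-s) else 0) -
      (if P ∈ badPrimes F n then 1 else 0) ≤
    ∑ ψ : X, (idealChar χ (natChar ψ.1) s P.asIdeal).re := by
  set N := Ideal.absNorm P.asIdeal with hN
  have h1 (ψ : torsionChars n (ℓ ^ (Nat.card (ZMod n)ˣ).factorization ℓ)) :
      idealChar χ (natChar ψ.1) s P.asIdeal = χ (ClassGroup.mk0 (primeIdeal P)) *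
        natChar ψ.1 N * (((N : ℝ) ^ (-s) : ℝ) : ℂ) := idealChar_coe χ _ s (primeIdeal P)
  have h0 : (0 : ℝ) ≤ (N : ℝ) ^ (-s) := by positivity
  rw [← Complex.re_sum, Finset.sum_congr rfl fun ψ _ => h1 ψ, ← Finset.sum_mul, ← Finset.mul_sum]
  by_cases hb : N.Coprime n
  · have hbad : P ∉ badPrimes F n := not_not.mpr hb
    rw [if_neg hbad, Finset.sum_congr rfl fun ψ _ => natChar_apply_unit ψ.1 hb,
      sum_torsionChars_apply hℓ, ZMod.coe_unitOfCoprime]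
    by_cases hg : ℓ.Coprime (orderOf (N : ZMod n))
    · have hP : IsGood n ℓ P := ⟨hb, hg⟩
      rw [if_pos hg, if_pos hP, hχ P hP, one_mul, ← Complex.ofReal_natCast, ← Complex.ofReal_mul,
        Complex.ofReal_re, sub_zero]
    · have hP : ¬ IsGood n ℓ P := fun h => hg h.2
      rw [if_neg hg, if_neg hP]
      simp
  · have hP : ¬ IsGood n ℓ P := fun h => hb h.1
    have hbad : P ∈ badPrimes F n := hb
    rw [if_pos hbad, if_neg hP, sum_natChar_of_not_coprime hb, mul_one, mul_zero, zero_sub]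
    have h2 : (N : ℝ) ^ (-s) ≤ 1 / 2 := absNorm_rpow_le_half hs P
    refine (abs_le.mp ((Complex.abs_re_le_norm _).trans ?_)).1
    rw [norm_mul, norm_classChar_apply, Complex.norm_of_nonneg h0]
    linarith

lemma exp_goodSum_le_prod (hℓ : ℓ.Prime) {χ : ClassGroup (𝓞 F) →* ℂ}
    (hχ : ∀ P : HeightOneSpectrum (𝓞 F), IsGood n ℓ P → χ (ClassGroup.mk0 (primeIdeal P)) = 1)
    {s : ℝ} (hs : 1 < s) :
    letI X := torsionChars n (ℓ ^ (Nat.card (ZMod n)ˣ).factorization ℓ)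
    Real.exp (Nat.card X * goodSum F n ℓ s - badCount F n - Nat.card X * (primeSumTwo F / 2)) ≤
      ∏ ψ : X, ‖∑' I, idealChar χ (natChar ψ.1) s I‖ := by
  classical
  set X := torsionChars n (ℓ ^ (Nat.card (ZMod n)ˣ).factorization ℓ)
  have key (ψ : X) := exp_re_le_norm_tsum_idealChar χ (natChar ψ.1) (norm_natChar_le ψ.1) hs
  refine le_trans ?_ (Finset.prod_le_prod (fun _ _ => (Real.exp_pos _).le) fun ψ _ => (key ψ).2)
  rw [← Real.exp_sum, Finset.sum_sub_distrib, Finset.sum_const, Finset.card_univ,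
    ← Nat.card_eq_fintype_card, nsmul_eq_mul, ← Summable.tsum_finsetSum fun ψ _ => (key ψ).1]
  refine Real.exp_le_exp.mpr (sub_le_sub_right ?_ _)
  have h1 := (summable_good F n ℓ hs).mul_left (Nat.card X : ℝ)
  have h2 := summable_bad F n
  rw [goodSum, badCount, ← tsum_mul_left, ← h1.tsum_sub h2]
  exact (h1.sub h2).tsum_le_tsum (le_sum_re_idealChar hℓ hχ hs) (summable_sum fun ψ _ => (key ψ).1)

lemma exists_norm_tsum_idealChar_le {σ₁ σ₂ : F →+* ℝ} (h : IsRealPair σ₁ σ₂)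
    (χ : ClassGroup (𝓞 F) →* ℂ) {k : ℕ} (hk : Odd k) (ψ : torsionChars n k) (hψ : ψ ≠ 1) :
    ∃ B : ℝ, ∀ s : ℝ, 1 < s → s < 2 → ‖∑' I, idealChar χ (natChar ψ.1) s I‖ ≤ B := by
  obtain ⟨a, ha⟩ := exists_apply_sq_ne_one hk ψ hψ
  choose B hB using exists_norm_tsum_class_le h ψ.1 a ha
  refine ⟨∑ C, B C, fun s hs1 hs2 => ?_⟩
  rw [tsum_idealChar_eq_sum_class χ _ (norm_natChar_le ψ.1) hs1]
  refine norm_sum_le_of_le _ fun C _ => ?_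
  rw [norm_mul, norm_classChar_apply, one_mul]
  simp only [natChar_apply (fun h => hψ (Subtype.ext h) : ψ.1 ≠ 1)]
  exact hB C s hs1 hs2

lemma tendsto_sub_one_mul_norm_tsum_idealChar {χ : ClassGroup (𝓞 F) →* ℂ} (hχ : χ ≠ 1) :
    Tendsto (fun s : ℝ => (s - 1) * ‖∑' I, idealChar χ 1 s I‖) (𝓝[>] 1) (𝓝 0) := by
  have h1 : Tendsto (fun s : ℝ => ∑ C : ClassGroup (𝓞 F), χ C * (((s - 1) *
      ∑' I : {I : (Ideal (𝓞 F))⁰ // ClassGroup.mk0 I = C},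
        (Ideal.absNorm (I : Ideal (𝓞 F)) : ℝ) ^ (-s) : ℝ) : ℂ)) (𝓝[>] 1)
      (𝓝 (∑ C : ClassGroup (𝓞 F), χ C * (classDensity F : ℂ))) :=
    tendsto_finsetSum _ fun C _ => ((Complex.continuous_ofReal.tendsto _).comp
      (tendsto_sub_one_mul_tsum_class C)).const_mul _
  rw [← Finset.sum_mul, sum_hom_units_eq_zero χ hχ, zero_mul] at h1
  refine (norm_zero (E := ℂ) ▸ h1.norm).congr' ?_
  filter_upwards [self_mem_nhdsWithin] with s (hs : 1 < s)
  rw [tsum_idealChar_eq_sum_class χ _ (by simp) hs]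
  have h2 : (s - 1) = ‖((s - 1 : ℝ) : ℂ)‖ := (Complex.norm_of_nonneg (by linarith)).symm
  rw [h2, ← norm_mul, ← h2, Finset.mul_sum]
  refine congrArg norm (Finset.sum_congr rfl fun C _ => ?_)
  rw [Complex.ofReal_mul, Complex.ofReal_tsum]
  simp only [MonoidHom.one_apply, one_mul]
  ring

theorem classChar_eq_one_of_good {σ₁ σ₂ : F →+* ℝ} (h : IsRealPair σ₁ σ₂) (hℓ : ℓ.Prime)
    (hodd : Odd ℓ)
    (hgood : ∀ Q : HeightOneSpectrum (𝓞 M), (Ideal.absNorm Q.asIdeal).Coprime n → IsGood n ℓ Q)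
    (hd : finrank F M ≤
      Nat.card (torsionChars n (ℓ ^ (Nat.card (ZMod n)ˣ).factorization ℓ)))
    {χ : ClassGroup (𝓞 F) →* ℂ}
    (hχ : ∀ P : HeightOneSpectrum (𝓞 F), IsGood n ℓ P → χ (ClassGroup.mk0 (primeIdeal P)) = 1) :
    χ = 1 := by
  classical
  by_contra hχ1
  set X := torsionChars n (ℓ ^ (Nat.card (ZMod n)ˣ).factorization ℓ) with hX
  have hB (ψ : X) : ∃ B : ℝ, ψ ≠ 1 → ∀ s : ℝ, 1 < s → s < 2 →
      ‖∑' I, idealChar χ (natChar ψ.1) s I‖ ≤ B := by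
    by_cases hψ : ψ = 1
    · exact ⟨0, fun h => absurd hψ h⟩
    · obtain ⟨B, hB⟩ := exists_norm_tsum_idealChar_le h χ (hodd.pow) ψ hψ
      exact ⟨B, fun _ => hB⟩
  choose B hB using hB
  set A := Real.exp (finrank F M * (primeSumTwo F + badCount F n) + 2 * primeSumTwo M +
    badCount F n + Nat.card X * (primeSumTwo F / 2)) with hA
  have key : ∀ s : ℝ, 1 < s → s < 2 →
      (s - 1) * ∑' I : (Ideal (𝓞 M))⁰, (Ideal.absNorm (I : Ideal (𝓞 M)) : ℝ) ^ (-s) ≤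
        (s - 1) * ‖∑' I, idealChar χ 1 s I‖ * (A * ∏ ψ ∈ Finset.univ.erase (1 : X), B ψ) := by
    intro s hs1 hs2
    rw [mul_assoc]
    refine mul_le_mul_of_nonneg_left ?_ (by linarith)
    calc _ ≤ _ := tsum_absNorm_rpow_le_exp_goodSum (F := F) hs1 hgood
      _ ≤ A * Real.exp (Nat.card X * goodSum F n ℓ s - badCount F n -
          Nat.card X * (primeSumTwo F / 2)) := by
        rw [hA, ← Real.exp_add]
        refine Real.exp_le_exp.mpr ?_
        have h1 : (finrank F M : ℝ) * goodSum F n ℓ s ≤ Nat.card X * goodSum F n ℓ s :=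
          mul_le_mul_of_nonneg_right (by exact_mod_cast hd) (goodSum_nonneg s)
        linarith
      _ ≤ A * ∏ ψ : X, ‖∑' I, idealChar χ (natChar ψ.1) s I‖ :=
        mul_le_mul_of_nonneg_left (exp_goodSum_le_prod hℓ hχ hs1) (Real.exp_pos _).le
      _ = ‖∑' I, idealChar χ 1 s I‖ * (A * ∏ ψ ∈ Finset.univ.erase (1 : X),
          ‖∑' I, idealChar χ (natChar ψ.1) s I‖) := by
        rw [← Finset.mul_prod_erase _ _ (Finset.mem_univ (1 : X)), Subgroup.coe_one, natChar_one]
        ring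
      _ ≤ _ := by
        refine mul_le_mul_of_nonneg_left (mul_le_mul_of_nonneg_left ?_ (Real.exp_pos _).le)
          (norm_nonneg _)
        exact Finset.prod_le_prod (fun _ _ => norm_nonneg _)
          fun ψ hψ => hB ψ (Finset.ne_of_mem_erase hψ) s hs1 hs2
  have hlim := (tendsto_sub_one_mul_norm_tsum_idealChar hχ1).mul_const
    (A * ∏ ψ ∈ Finset.univ.erase (1 : X), B ψ)
  rw [zero_mul] at hlim
  have h1 := le_of_tendsto_of_tendsto (tendsto_sub_one_mul_tsum_absNorm (K := M)) hlim (by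
    have : Set.Ioo (1 : ℝ) 2 ∈ 𝓝[>] (1 : ℝ) := Ioo_mem_nhdsGT one_lt_two
    filter_upwards [this] with s hs
    exact key s hs.1 hs.2)
  have h2 : 0 < (classNumber M : ℝ) * classDensity M :=
    mul_pos (by exact_mod_cast Fintype.card_pos) (classDensity_pos M)
  linarith

end Comparison

section Cyclotomic

variable {F L : Type*} [Field F] [NumberField F] [Field L] [NumberField L] [Algebra F L]
  {n : ℕ} [NeZero n] [IsCyclotomicExtension {n} ℚ L] {ℓ : ℕ}

lemma coprime_card_ker_comp_pow {G A : Type*} [Group G] [Finite G] [CommGroup A] {ι : G →* A}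
    (hι : Function.Injective ι) (hℓ : ℓ.Prime) {m : ℕ} (hm : ℓ.Coprime m) :
    ℓ.Coprime (Nat.card ((powMonoidHom m).comp ι).ker) := by
  have : Fact ℓ.Prime := ⟨hℓ⟩
  refine hℓ.coprime_iff_not_dvd.mpr fun hdvd => ?_
  obtain ⟨g, hg⟩ := exists_prime_orderOf_dvd_card' ℓ hdvd
  have h1 : (g : G) ^ m = 1 := hι (by
    rw [map_pow, map_one]
    exact g.2)
  have h2 := orderOf_dvd_of_pow_eq_one h1
  rw [Subgroup.orderOf_coe, hg] at h2
  exact (hℓ.coprime_iff_not_dvd.mp hm) h2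

variable (F L n) in
lemma exists_galois_units_injective : ∃ ι : Gal(L/F) →* (ZMod n)ˣ, Function.Injective ι :=
  ⟨((IsCyclotomicExtension.zeta_spec n ℚ L).autToPow ℚ).comp (AlgEquiv.restrictScalarsHom ℚ),
    ((IsCyclotomicExtension.zeta_spec n ℚ L).autToPow_injective ℚ).comp
      (AlgEquiv.restrictScalars_injective ℚ)⟩

variable (F L n) in
lemma exists_intermediateField_coprime_finrank [IsGalois F L] (hℓ : ℓ.Prime) :
    ∃ M : IntermediateField F L, ℓ.Coprime (finrank M L) ∧
      finrank F M ≤ Nat.card (torsionChars n (ℓ ^ (Nat.card (ZMod n)ˣ).factorization ℓ)) := by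
  obtain ⟨ι, hι⟩ := exists_galois_units_injective F L n
  set k := ℓ ^ (Nat.card (ZMod n)ˣ).factorization ℓ
  set m := Nat.card (ZMod n)ˣ / k with hm
  have hmk : k * m = Nat.card (ZMod n)ˣ := Nat.ordProj_mul_ordCompl_eq_self _ ℓ
  have hcop : ℓ.Coprime m := Nat.coprime_ordCompl hℓ Nat.card_pos.ne'
  set T := ((powMonoidHom m).comp ι).ker with hT
  refine ⟨fixedField T, ?_, ?_⟩
  · rw [finrank_fixedField_eq_card]
    exact coprime_card_ker_comp_pow hι hℓ hcop
  · have h1 : finrank F (fixedField T) * Nat.card T = T.index * Nat.card T := by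
      rw [Subgroup.index_mul_card, IsGalois.card_aut_eq_finrank, ← finrank_fixedField_eq_card T,
        finrank_mul_finrank]
    rw [Nat.eq_of_mul_eq_mul_right Nat.card_pos h1, hT, Subgroup.index_ker, card_torsionChars]
    refine Nat.card_mono (Set.toFinite _) ?_
    rintro _ ⟨g, rfl⟩
    change (ι g ^ m) ^ k = 1
    rw [← pow_mul, mul_comm, hmk, pow_card_eq_one']

lemma isGood_of_coprime_finrank {M : Type*} [Field M] [NumberField M] [Algebra M L] [IsGalois M L]
    (hM : ℓ.Coprime (finrank M L)) (Q : HeightOneSpectrum (𝓞 M))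
    (hQ : (Ideal.absNorm Q.asIdeal).Coprime n) : IsGood n ℓ Q := by
  obtain ⟨𝔏, rfl⟩ := exists_primeBelow_eq L Q
  refine ⟨hQ, ?_⟩
  rw [← inertiaDeg_eq_orderOf 𝔏 _ hQ]
  exact hM.coprime_dvd_right (inertiaDeg_dvd_finrank 𝔏)

lemma classChar_eq_one_of_isGood {χ : ClassGroup (𝓞 F) →* ℂ} (hχℓ : ∀ C, χ C ^ ℓ = 1)
    (hχ : ∀ (𝔞 : Ideal (𝓞 L)) (I : (Ideal (𝓞 F))⁰),
      (I : Ideal (𝓞 F)) = Ideal.relNorm (𝓞 F) 𝔞 → χ (ClassGroup.mk0 I) = 1)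
    {P : HeightOneSpectrum (𝓞 F)} (hP : IsGood n ℓ P) :
    χ (ClassGroup.mk0 (primeIdeal P)) = 1 := by
  obtain ⟨𝔏, rfl⟩ := exists_primeBelow_eq L P
  have h1 := 𝔏.isMaximal
  have h2 := (primeBelow F 𝔏).isMaximal
  have h3 := hχ 𝔏.asIdeal (primeIdeal (primeBelow F 𝔏) ^ orderOf
    ((Ideal.absNorm (primeBelow F 𝔏).asIdeal : ℕ) : ZMod n)) (by
      rw [Ideal.relNorm_eq_pow_of_isMaximal 𝔏.asIdeal (primeBelow F 𝔏).asIdeal,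
        inertiaDeg_eq_orderOf 𝔏 (primeBelow F 𝔏) hP.1, SubmonoidClass.coe_pow, primeIdeal])
  rw [map_pow, map_pow] at h3
  have h4 := Nat.dvd_gcd (orderOf_dvd_of_pow_eq_one (hχℓ _)) (orderOf_dvd_of_pow_eq_one h3)
  rw [Nat.coprime_iff_gcd_eq_one.mp hP.2] at h4
  exact orderOf_eq_one_iff.mp (Nat.dvd_one.mp h4)

theorem classChar_eq_one_of_relNorm (n : ℕ) [NeZero n] [IsCyclotomicExtension {n} ℚ L]
    {σ₁ σ₂ : F →+* ℝ} (h : IsRealPair σ₁ σ₂) (hℓ : ℓ.Prime)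
    (hodd : Odd ℓ) {χ : ClassGroup (𝓞 F) →* ℂ} (hχℓ : ∀ C, χ C ^ ℓ = 1)
    (hχ : ∀ (𝔞 : Ideal (𝓞 L)) (I : (Ideal (𝓞 F))⁰),
      (I : Ideal (𝓞 F)) = Ideal.relNorm (𝓞 F) 𝔞 → χ (ClassGroup.mk0 I) = 1) : χ = 1 := by
  have hgal : IsGalois ℚ L := IsCyclotomicExtension.isGalois {n} ℚ L
  have : IsGalois F L := IsGalois.tower_top_of_isGalois ℚ F L
  obtain ⟨M, hM, hd⟩ := exists_intermediateField_coprime_finrank F L n hℓ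
  exact classChar_eq_one_of_good h hℓ hodd (isGood_of_coprime_finrank (L := L) hM) hd
    fun P hP => classChar_eq_one_of_isGood (n := n) (L := L) hχℓ hχ hP

end Cyclotomic

section GroupTheory

variable {A B : Type*} [CommGroup A] [CommGroup B] {ℓ : ℕ}

lemma exists_eq_mul_pow_pow (f : A →* B) (h : ∀ b, ∃ a c, b = f a * c ^ ℓ) (j : ℕ) (b : B) :
    ∃ a c, b = f a * c ^ ℓ ^ j := by
  induction j with
  | zero => exact ⟨1, b, by simp⟩
  | succ j ih =>
    obtain ⟨a, c, hac⟩ := ih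
    obtain ⟨a', c', rfl⟩ := h c
    exact ⟨a * a' ^ ℓ ^ j, c', by rw [hac, mul_pow, map_mul, map_pow, ← pow_mul, pow_succ', mul_assoc]⟩

lemma mem_pPart_iff (hℓ : ℓ.Prime) {a : A} : a ∈ pPart A ℓ hℓ ↔ ∃ j : ℕ, a ^ ℓ ^ j = 1 :=
  .rfl

lemma exists_mem_pPart_of_eq_mul_pow [Finite A] [Finite B] (hℓ : ℓ.Prime) (f : A →* B)
    (h : ∀ b, ∃ a c, b = f a * c ^ ℓ) {b : B} (hb : b ∈ pPart B ℓ hℓ) :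
    ∃ a ∈ pPart A ℓ hℓ, f a = b := by
  obtain ⟨a, c, hac⟩ := exists_eq_mul_pow_pow f h ((Nat.card B).factorization ℓ) b
  set r := Nat.card B / ℓ ^ (Nat.card B).factorization ℓ
  set s := Nat.card A / ℓ ^ (Nat.card A).factorization ℓ
  have hr : ℓ ^ (Nat.card B).factorization ℓ * r = Nat.card B := Nat.ordProj_mul_ordCompl_eq_self _ ℓ
  have hs : ℓ ^ (Nat.card A).factorization ℓ * s = Nat.card A := Nat.ordProj_mul_ordCompl_eq_self _ ℓ
  have hrs : ℓ.Coprime (r * s) := (Nat.coprime_ordCompl hℓ Nat.card_pos.ne').mul_right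
    (Nat.coprime_ordCompl hℓ Nat.card_pos.ne')
  have h1 : b ^ (r * s) = f (a ^ (r * s)) := by
    rw [hac, mul_pow, ← pow_mul, ← mul_assoc, hr, pow_mul c, pow_card_eq_one', one_pow, mul_one,
      map_pow]
  obtain ⟨j, hj⟩ := (mem_pPart_iff hℓ).mp hb
  obtain ⟨t, ht⟩ := exists_pow_eq_self_of_coprime (x := b) (n := r * s)
    ((hrs.pow_left j).symm.coprime_dvd_right (orderOf_dvd_of_pow_eq_one hj))
  refine ⟨(a ^ (r * s)) ^ t, Subgroup.pow_mem _ ((mem_pPart_iff hℓ).mpr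
    ⟨(Nat.card A).factorization ℓ, ?_⟩) _, by rw [map_pow, ← h1, ht]⟩
  rw [← pow_mul, mul_assoc, mul_comm s, hs, mul_comm, pow_mul, pow_card_eq_one', one_pow]

lemma isCyclic_pPart_of_pRank_eq_one [Finite A] (hℓ : ℓ.Prime) (h : pRank A ℓ hℓ = 1) :
    IsCyclic (pPart A ℓ hℓ) := by
  have : Fact ℓ.Prime := ⟨hℓ⟩
  set P := pPart A ℓ hℓ
  have hP : IsPGroup ℓ P := fun a => by
    obtain ⟨j, hj⟩ := (mem_pPart_iff hℓ).mp a.2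
    exact ⟨j, Subtype.ext hj⟩
  set R := (powMonoidHom ℓ : P →* P).range
  have hcard : Nat.card (P ⧸ R) = ℓ := by
    obtain ⟨i, hi⟩ := (hP.to_quotient R).exists_card_eq
    have h1 : (Nat.card (P ⧸ R)).factorization ℓ = 1 := h
    rw [hi, hℓ.factorization_pow, Finsupp.single_eq_same] at h1
    rw [hi, h1, pow_one]
  have hcyc : IsCyclic (P ⧸ R) := isCyclic_of_prime_card hcard
  obtain ⟨g, hg⟩ := hcyc.exists_generator
  obtain ⟨x, rfl⟩ := QuotientGroup.mk_surjective g
  refine ⟨x, fun y => ?_⟩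
  have key : ∀ b, ∃ (a : Subgroup.zpowers x) (c : P), b = (Subgroup.zpowers x).subtype a * c ^ ℓ := by
    intro b
    obtain ⟨i, hi⟩ := Subgroup.mem_zpowers_iff.mp (hg b)
    rw [← QuotientGroup.mk_zpow, QuotientGroup.eq] at hi
    obtain ⟨c, hc⟩ := hi
    refine ⟨⟨x ^ i, i, rfl⟩, c, ?_⟩
    change c ^ ℓ = _ at hc
    rw [hc, Subgroup.subtype_apply, mul_inv_cancel_left]
  obtain ⟨i, hi⟩ := hP.exists_card_eq
  obtain ⟨a, c, hac⟩ := exists_eq_mul_pow_pow _ key i y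
  rw [← hi, pow_card_eq_one', mul_one] at hac
  rw [hac]
  exact a.2

lemma nonempty_mulEquiv_multiplicative_zmod [Finite A] [IsCyclic A] {k : ℕ} (h : Nat.card A = k) :
    Nonempty (A ≃* Multiplicative (ZMod k)) :=
  ⟨mulEquivOfCyclicCardEq (by rw [h, Nat.card_congr Multiplicative.toAdd, Nat.card_zmod])⟩

lemma structure_of_surjective_cyclic [Finite A] [IsCyclic B] (hℓ : ℓ.Prime) {m : ℕ} (hm : 1 ≤ m)
    (hA : Nat.card A = ℓ ^ m) (hB : Nat.card B = ℓ ^ (m - 1)) (f : A →* B)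
    (hf : Function.Surjective f) :
    Nonempty (A ≃* Multiplicative (ZMod (ℓ ^ m))) ∨
      Nonempty (A ≃* Multiplicative (ZMod (ℓ ^ (m - 1)) × ZMod ℓ)) := by
  have : Fact ℓ.Prime := ⟨hℓ⟩
  obtain ⟨b, hb⟩ := IsCyclic.exists_ofOrder_eq_natCard (α := B)
  obtain ⟨a, rfl⟩ := hf b
  have hmm : ℓ ^ m = ℓ ^ (m - 1) * ℓ := by rw [← pow_succ, Nat.sub_add_cancel hm]
  have hker : Nat.card f.ker = ℓ := by
    have h1 := Subgroup.index_mul_card f.ker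
    rw [Subgroup.index_ker, MonoidHom.range_eq_top.mpr hf, Subgroup.card_top, hA, hB, hmm] at h1
    exact Nat.eq_of_mul_eq_mul_left (pow_pos hℓ.pos _) h1
  obtain ⟨i, hi, hai⟩ := (Nat.dvd_prime_pow hℓ).mp (hA ▸ orderOf_dvd_natCard a)
  have h2 : m - 1 ≤ i := by
    have h3 := orderOf_map_dvd f a
    rw [hb, hB, hai] at h3
    exact (Nat.pow_dvd_pow_iff_le_right hℓ.one_lt).mp h3
  rcases hi.eq_or_lt with rfl | hlt
  · left
    have := isCyclic_of_orderOf_eq_card a (hai.trans hA.symm)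
    exact nonempty_mulEquiv_multiplicative_zmod hA
  · right
    obtain rfl : i = m - 1 := by omega
    have hdisj : Disjoint (Subgroup.zpowers a) f.ker := by
      rw [Subgroup.disjoint_def]
      rintro _ ⟨z, rfl⟩ hz
      have h4 : f a ^ z = 1 := by
        rw [← map_zpow]
        exact hz
      have h5 := orderOf_dvd_iff_zpow_eq_one.mpr h4
      rw [hb, hB, ← hai] at h5
      exact orderOf_dvd_iff_zpow_eq_one.mp h5
    have hcompl : Subgroup.IsComplement' (Subgroup.zpowers a) f.ker :=
      Subgroup.isComplement'_of_card_mul_and_disjoint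
        (by rw [Nat.card_zpowers, hai, hker, hA, hmm]) hdisj
    obtain ⟨e₁⟩ := nonempty_mulEquiv_multiplicative_zmod (A := Subgroup.zpowers a)
      ((Nat.card_zpowers a).trans hai)
    have := isCyclic_of_prime_card hker
    obtain ⟨e₂⟩ := nonempty_mulEquiv_multiplicative_zmod hker
    let e : Subgroup.zpowers a × f.ker ≃* A := MulEquiv.ofBijective
      ((Subgroup.zpowers a).subtype.coprod f.ker.subtype) hcompl
    exact ⟨e.symm.trans ((e₁.prodCongr e₂).trans (MulEquiv.prodMultiplicative _ _).symm)⟩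

end GroupTheory

section ClassNorm

variable (F : Type*) {H : Type*} [Field F] [NumberField F] [Field H] [NumberField H] [Algebra F H]

/-- The relative norm on nonzero ideals. -/
def idealNorm : (Ideal (𝓞 H))⁰ →* (Ideal (𝓞 F))⁰ where
  toFun I := ⟨Ideal.relNorm (𝓞 F) (I : Ideal (𝓞 H)), mem_nonZeroDivisors_of_ne_zero
    (mt Ideal.relNorm_eq_bot_iff.mp (nonZeroDivisors.coe_ne_zero I))⟩
  map_one' := Subtype.ext (map_one _)
  map_mul' I J := Subtype.ext (map_mul (Ideal.relNorm (𝓞 F)) (I : Ideal (𝓞 H)) J)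

lemma mk0_idealNorm_eq {I J : (Ideal (𝓞 H))⁰} (h : ClassGroup.mk0 I = ClassGroup.mk0 J) :
    ClassGroup.mk0 (idealNorm F I) = ClassGroup.mk0 (idealNorm F J) := by
  obtain ⟨x, y, hx, hy, hxy⟩ := ClassGroup.mk0_eq_mk0_iff.mp h
  refine ClassGroup.mk0_eq_mk0_iff.mpr ⟨Algebra.intNorm (𝓞 F) (𝓞 H) x,
    Algebra.intNorm (𝓞 F) (𝓞 H) y, ?_, ?_, ?_⟩
  · rwa [Ne, Algebra.intNorm_eq_zero]
  · rwa [Ne, Algebra.intNorm_eq_zero]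
  · have h1 := congrArg (Ideal.relNorm (𝓞 F)) hxy
    rw [map_mul, map_mul, Ideal.relNorm_singleton, Ideal.relNorm_singleton] at h1
    exact h1

/-- The norm homomorphism of class groups. -/
def classNorm : ClassGroup (𝓞 H) →* ClassGroup (𝓞 F) where
  toFun C := ClassGroup.mk0 (idealNorm F (ClassGroup.mk0_surjective C).choose)
  map_one' := (mk0_idealNorm_eq F (J := 1)
    ((ClassGroup.mk0_surjective 1).choose_spec.trans (map_one _).symm)).trans
      (by rw [map_one, map_one])
  map_mul' C D := by
    rw [← map_mul, ← map_mul]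
    refine mk0_idealNorm_eq F ?_
    rw [map_mul, (ClassGroup.mk0_surjective _).choose_spec,
      (ClassGroup.mk0_surjective C).choose_spec, (ClassGroup.mk0_surjective D).choose_spec]

lemma classNorm_mk0 (I : (Ideal (𝓞 H))⁰) :
    classNorm F (ClassGroup.mk0 I) = ClassGroup.mk0 (idealNorm F I) :=
  mk0_idealNorm_eq F (ClassGroup.mk0_surjective _).choose_spec

variable {F} {ℓ : ℕ}

lemma exists_eq_mul_pow_of_char {A B : Type*} [CommGroup A] [CommGroup B] [Finite B] (f : A →* B)
    (h : ∀ χ : B →* ℂ, (∀ b, χ b ^ ℓ = 1) → (∀ a, χ (f a) = 1) → χ = 1) (b : B) :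
    ∃ a c, b = f a * c ^ ℓ := by
  set R := f.range ⊔ (powMonoidHom ℓ : B →* B).range with hR
  suffices hb : b ∈ R by
    obtain ⟨_, ⟨a, rfl⟩, _, ⟨c, rfl⟩, rfl⟩ := Subgroup.mem_sup.mp hb
    exact ⟨a, c, rfl⟩
  by_contra hb
  have hb1 : (b : B ⧸ R) ≠ 1 := mt (QuotientGroup.eq_one_iff b).mp hb
  obtain ⟨φ, hφ⟩ := CommGroup.exists_apply_ne_one_of_hasEnoughRootsOfUnity (B ⧸ R) ℂ hb1
  have h0 : ∀ x ∈ R, φ (x : B ⧸ R) = 1 := fun x hx => by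
    rw [(QuotientGroup.eq_one_iff x).mpr hx, map_one]
  have h1 := h ((Units.coeHom ℂ).comp (φ.comp (QuotientGroup.mk' R)))
    (fun c => by
      change ((φ (c : B ⧸ R) : ℂˣ) : ℂ) ^ ℓ = 1
      rw [← Units.val_pow_eq_pow_val, ← map_pow, ← QuotientGroup.mk_pow,
        h0 (c ^ ℓ) (Subgroup.mem_sup_right ⟨c, rfl⟩), Units.val_one])
    (fun a => by
      change ((φ (f a : B ⧸ R) : ℂˣ) : ℂ) = 1
      rw [h0 (f a) (Subgroup.mem_sup_left ⟨a, rfl⟩), Units.val_one])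
  exact hφ (Units.ext (DFunLike.congr_fun h1 b))

theorem exists_eq_classNorm_mul_pow (L : Type*) [Field L] [NumberField L] [Algebra F L]
    [Algebra H L] [IsScalarTower F H L] (n : ℕ) [NeZero n] [IsCyclotomicExtension {n} ℚ L]
    {σ₁ σ₂ : F →+* ℝ} (h : IsRealPair σ₁ σ₂) (hℓ : ℓ.Prime) (hodd : Odd ℓ)
    (C : ClassGroup (𝓞 F)) :
    ∃ (D : ClassGroup (𝓞 H)) (E : ClassGroup (𝓞 F)), C = classNorm F D * E ^ ℓ := by
  refine exists_eq_mul_pow_of_char _ (fun χ hχℓ hχ => ?_) C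
  refine classChar_eq_one_of_relNorm (L := L) n h hℓ hodd hχℓ fun 𝔞 I hI => ?_
  have h𝔞 : Ideal.relNorm (𝓞 H) 𝔞 ∈ (Ideal (𝓞 H))⁰ := by
    refine mem_nonZeroDivisors_of_ne_zero fun h0 => nonZeroDivisors.coe_ne_zero I ?_
    rw [hI, ← Ideal.relNorm_relNorm (𝓞 F) (𝓞 H) 𝔞, h0, map_zero]
  have h1 : I = idealNorm F ⟨_, h𝔞⟩ := Subtype.ext (hI.trans
    (Ideal.relNorm_relNorm (𝓞 F) (𝓞 H) 𝔞).symm)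
  rw [h1, ← classNorm_mk0]
  exact hχ _

end ClassNorm

section RealCyclotomic

lemma isPrimitiveRoot_zetaC (n : ℕ) [NeZero n] : IsPrimitiveRoot (zetaC n) n :=
  Complex.isPrimitiveRoot_exp n (NeZero.ne n)

instance (n : ℕ) [NeZero n] : FiniteDimensional ℚ ℚ⟮zetaC n⟯ :=
  IntermediateField.adjoin.finiteDimensional
    (isIntegral_of_pow_eq_one (NeZero.ne n) (zetaC_pow n (NeZero.ne n)))

lemma isCyclotomicExtension_adjoin_zetaC (n : ℕ) [NeZero n] :
    IsCyclotomicExtension {n} ℚ ℚ⟮zetaC n⟯ := by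
  change IsCyclotomicExtension {n} ℚ ℚ⟮zetaC n⟯.toSubalgebra
  rw [IntermediateField.adjoin_simple_toSubalgebra_of_isAlgebraic
    (isIntegral_of_pow_eq_one (NeZero.ne n) (zetaC_pow n (NeZero.ne n))).isAlgebraic]
  exact (isPrimitiveRoot_zetaC n).adjoin_isCyclotomicExtension ℚ

lemma realCyclo_le_adjoin_zetaC (n : ℕ) : realCyclo n ≤ ℚ⟮zetaC n⟯ :=
  IntermediateField.adjoin_simple_le_iff.mpr
    (add_mem (IntermediateField.mem_adjoin_simple_self ℚ _)
      (inv_mem (IntermediateField.mem_adjoin_simple_self ℚ _)))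

lemma realCyclo_le_fieldRange_ofReal (n : ℕ) [NeZero n] :
    realCyclo n ≤ (Complex.ofRealAm.restrictScalars ℚ).fieldRange := by
  refine IntermediateField.adjoin_simple_le_iff.mpr ⟨2 * (zetaC n).re, ?_⟩
  have h1 : ‖zetaC n‖ = 1 := (isPrimitiveRoot_zetaC n).norm'_eq_one (NeZero.ne n)
  rw [Complex.inv_eq_conj h1, Complex.add_conj]
  simp

lemma exists_ringHom_real (n : ℕ) [NeZero n] {K : IntermediateField ℚ ℂ} (hK : K ≤ realCyclo n) :
    Nonempty (K →+* ℝ) :=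
  ⟨((Complex.ofRealAm.restrictScalars ℚ).equivFieldRange.symm.toAlgHom.comp
    (IntermediateField.inclusion (hK.trans (realCyclo_le_fieldRange_ofReal n)))).toRingHom⟩

lemma exists_isRealPair {F : Type*} [Field F] [NumberField F] (h : finrank ℚ F = 2)
    (σ : F →+* ℝ) : ∃ τ : F →+* ℝ, IsRealPair σ τ := by
  have : Algebra.IsQuadraticExtension ℚ F := ⟨h⟩
  have : IsGalois ℚ F := ⟨⟩
  have hcard : Nat.card Gal(F/ℚ) = 2 := (IsGalois.card_aut_eq_finrank ℚ F).trans h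
  have : Nontrivial Gal(F/ℚ) := Finite.one_lt_card_iff_nontrivial.mp (by omega)
  obtain ⟨g, hg⟩ := exists_ne (1 : Gal(F/ℚ))
  refine ⟨σ.comp (g : F →+* F), fun h1 => hg (AlgEquiv.ext fun x => ?_), h⟩
  exact (σ.injective (DFunLike.congr_fun h1 x)).symm

theorem exists_eq_classNorm_mul_pow_realCyclo (n : ℕ) [NeZero n] {ℓ : ℕ} (hℓ : ℓ.Prime)
    (hodd : Odd ℓ) {K : IntermediateField ℚ ℂ} [FiniteDimensional ℚ K] (hK : K ≤ realCyclo n)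
    (h2 : finrank ℚ K = 2) :
    ∃ f : ClassGroup (𝓞 (realCyclo n)) →* ClassGroup (𝓞 K), ∀ C, ∃ D E, C = f D * E ^ ℓ := by
  let : Algebra K (realCyclo n) := (IntermediateField.inclusion hK).toAlgebra
  let : Algebra (realCyclo n) ℚ⟮zetaC n⟯ :=
    (IntermediateField.inclusion (realCyclo_le_adjoin_zetaC n)).toAlgebra
  let : Algebra K ℚ⟮zetaC n⟯ :=
    (IntermediateField.inclusion (hK.trans (realCyclo_le_adjoin_zetaC n))).toAlgebra
  have : IsScalarTower K (realCyclo n) ℚ⟮zetaC n⟯ := IsScalarTower.of_algebraMap_eq fun _ => rfl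
  have : IsCyclotomicExtension {n} ℚ ℚ⟮zetaC n⟯ := by
    convert isCyclotomicExtension_adjoin_zetaC n
  obtain ⟨σ⟩ := exists_ringHom_real n hK
  obtain ⟨τ, hστ⟩ := exists_isRealPair (by convert h2) σ
  exact ⟨classNorm K, exists_eq_classNorm_mul_pow ℚ⟮zetaC n⟯ n hστ hℓ hodd⟩

end RealCyclotomic

end

/-- structure of `C(H)_ℓ` when `C(K₂)_ℓ` is cyclic
(under the hypotheses of Theorem 1.2). -/
theorem statement_18
    (n : ℕ) (hn : 0 < n)
    (ℓ : ℕ) (hℓ : ℓ.Prime) (hℓodd : Odd ℓ)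
    (q : ℕ) (hq : q.Prime) (hqn : q ∣ n) (hqℓ : q ≡ 1 [MOD ℓ])
    (m : ℕ) (hm : 1 ≤ m)
    (K₂ : IntermediateField ℚ ℂ) [FiniteDimensional ℚ K₂]
    (hK₂H : K₂ ≤ realCyclo n) (hK₂deg : Module.finrank ℚ K₂ = 2)
    (hH : pCard (ClassGroup (𝓞 (realCyclo n))) ℓ hℓ = ℓ ^ m)
    (hK₂cl : pCard (ClassGroup (𝓞 K₂)) ℓ hℓ = ℓ ^ (m - 1))
    (hker : ∀ (F K : IntermediateField ℚ ℂ) [FiniteDimensional ℚ F] [FiniteDimensional ℚ K]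
      (hFK : F ≤ K), K ≤ realCyclo n → K₂ ≤ F →
      Module.finrank ℚ K = ℓ * Module.finrank ℚ F →
      pCard (ClassGroup (𝓞 F)) ℓ hℓ = ℓ ^ (m - 1) →
      pCard (ClassGroup (𝓞 K)) ℓ hℓ = ℓ ^ m →
      ∀ t : ClassGroup (𝓞 F) →* ClassGroup (𝓞 K), IsClassGroupExtHom hFK t →
        (Subsingleton ↥(pPart ↥t.ker ℓ hℓ) ∨ ∃ r : ℕ, 0 < r ∧
          Nonempty (↥(pPart ↥t.ker ℓ hℓ) ≃* Multiplicative (Fin r → ZMod ℓ))))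
    (hr₂ : pRank (ClassGroup (𝓞 K₂)) ℓ hℓ = 1) :
    Nonempty (↥(pPart (ClassGroup (𝓞 (realCyclo n))) ℓ hℓ) ≃*
        Multiplicative (ZMod (ℓ ^ m))) ∨
      Nonempty (↥(pPart (ClassGroup (𝓞 (realCyclo n))) ℓ hℓ) ≃*
        Multiplicative (ZMod (ℓ ^ (m - 1)) × ZMod ℓ)) := by
  have : NeZero n := ⟨hn.ne'⟩
  obtain ⟨f, hf⟩ := exists_eq_classNorm_mul_pow_realCyclo n hℓ hℓodd hK₂H hK₂deg
  have : IsCyclic (pPart (ClassGroup (𝓞 K₂)) ℓ hℓ) := isCyclic_pPart_of_pRank_eq_one hℓ hr₂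
  have hmaps : ∀ a ∈ pPart (ClassGroup (𝓞 (realCyclo n))) ℓ hℓ,
      f a ∈ pPart (ClassGroup (𝓞 K₂)) ℓ hℓ := fun a ⟨j, hj⟩ =>
    ⟨j, by rw [← map_pow, hj, map_one]⟩
  refine structure_of_surjective_cyclic hℓ hm hH hK₂cl
    ((f.comp (Subgroup.subtype _)).codRestrict _ fun a => hmaps a a.2) fun b => ?_
  obtain ⟨a, ha, hab⟩ := exists_mem_pPart_of_eq_mul_pow hℓ f hf b.2
  exact ⟨⟨a, ha⟩, Subtype.ext hab⟩

end PaperStmt
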